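/- arXiv:1703.06540 — 8 statements merged into one kernel-verified Lean document; each statement's English description precedes it below -/
import Mathlib

section
/- Let r ≥ 3 and n = 2r. The subgraph X'_{r,r} of X³_{r,r} induced on V' = {σ ∈ S_{2r} : for each i ∈ {1,…,r}, exactly one of i and r+i lies in σ⁻¹({1,…,r})} is connected and admits an efficient dominating set (equivalently, a perfect 1-sphere packing). -/
/-- The closed neighborhood `N[v]` of a vertex (the 1-sphere centered at `v`). -/
def closedNbr {V : Type*} (G : SimpleGraph V) (v : V) : Set V :=
  insert v (G.neighborSet v)

/-- A 1-sphere packing: a set of vertices with pairwise disjoint closed neighborhoods. -/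
def IsSpherePacking {V : Type*} (G : SimpleGraph V) (J : Set V) : Prop :=
  J.Pairwise fun u v => Disjoint (closedNbr G u) (closedNbr G v)

/-- An efficient dominating set: an independent set such that every vertex outside it
is adjacent to exactly one of its members. -/
def IsEDS {V : Type*} (G : SimpleGraph V) (J : Set V) : Prop :=
  (∀ u ∈ J, ∀ v ∈ J, ¬ G.Adj u v) ∧ ∀ v, v ∉ J → ∃! u, u ∈ J ∧ G.Adj v u

/-- An efficient dominating set of the subgraph of `G` induced on the set `S`. -/
def IsEDSOn {V : Type*} (G : SimpleGraph V) (S J : Set V) : Prop :=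
  J ⊆ S ∧ (∀ u ∈ J, ∀ v ∈ J, ¬ G.Adj u v) ∧
    ∀ v ∈ S, v ∉ J → ∃! u, u ∈ J ∧ G.Adj v u

/-- The Cayley graph `X(Sₙ, τ)` of the symmetric group on `Fin n` with connection set
the transpositions coming from the edges of the graph `τ`. -/
def cayley {n : ℕ} (τ : SimpleGraph (Fin n)) : SimpleGraph (Equiv.Perm (Fin n)) :=
  SimpleGraph.fromRel fun g h => ∃ i j : Fin n, τ.Adj i j ∧ h * g⁻¹ = Equiv.swap i j

/-- The double-star tree `τ³_{r,t}` on `{1,…,r+t}` (0-indexed on `Fin (r+t)`): edges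
`{i, r}` for `1 ≤ i ≤ r-1`, the central edge `{r, r+1}`, and `{r+1, j}` for `r+2 ≤ j ≤ n`
(1-indexed), i.e. 0-indexed: `{i, r-1}` for `i < r-1`, `{r-1, r}`, and `{r, j}` for `r < j`. -/
def doubleStar (r t : ℕ) : SimpleGraph (Fin (r + t)) :=
  SimpleGraph.fromRel fun i j =>
    ((i : ℕ) < r - 1 ∧ (j : ℕ) = r - 1) ∨ ((i : ℕ) = r - 1 ∧ (j : ℕ) = r) ∨
      ((i : ℕ) = r ∧ r < (j : ℕ))

/-- `X³_{r,t}`, the Cayley graph of the double-star tree. -/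
def X3 (r t : ℕ) : SimpleGraph (Equiv.Perm (Fin (r + t))) :=
  cayley (doubleStar r t)

/-- The star Cayley graph on `S_m` with center `m` (0-indexed: center `m-1`):
connection set the transpositions `(i, m-1)` with `i < m-1`. -/
def starGraph (m : ℕ) : SimpleGraph (Equiv.Perm (Fin m)) :=
  SimpleGraph.fromRel fun g h =>
    ∃ i j : Fin m, (i : ℕ) < m - 1 ∧ (j : ℕ) = m - 1 ∧ h * g⁻¹ = Equiv.swap i j

/-- A star-like Cayley graph on `Equiv.Perm (Fin n)` with center `c` and leaf set `S`:
connection set the transpositions `(i, c)` with `i ∈ S`. -/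
def starAt {n : ℕ} (c : Fin n) (S : Set (Fin n)) : SimpleGraph (Equiv.Perm (Fin n)) :=
  SimpleGraph.fromRel fun g h => ∃ i ∈ S, h * g⁻¹ = Equiv.swap i c

/-- The Johnson graph `Γ^r_n`: vertices the `r`-subsets of `{1,…,n}`, adjacency
meaning intersection of size `r-1`. -/
def johnson (n r : ℕ) : SimpleGraph {A : Finset (Fin n) // A.card = r} :=
  SimpleGraph.fromRel fun A B => (A.val ∩ B.val).card = r - 1

/-- A subgraph `Ψ` of `Γ^r_n` is exact if (a) any two of its edges incident to a common
vertex have colors sharing exactly `r-2` elements, and (b) the vertices of any path of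
length 2 in `Ψ` involve exactly `r+2` elements. -/
def IsExact {n r : ℕ} (Ψ : SimpleGraph {A : Finset (Fin n) // A.card = r}) : Prop :=
  (∀ u v w, Ψ.Adj u v → Ψ.Adj u w → v ≠ w →
    ((u.val ∩ v.val) ∩ (u.val ∩ w.val)).card = r - 2) ∧
  (∀ u v w, Ψ.Adj u v → Ψ.Adj v w → u ≠ w →
    (u.val ∪ v.val ∪ w.val).card = r + 2)

/-- A unicyclic caterpillar: a connected graph with exactly one cycle (for a finite
connected graph, `#edges = #vertices`) such that deleting its vertices of degree 1
leaves precisely that cycle (the subgraph induced on the vertices of degree at least 2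
is a (connected, 2-regular) cycle). -/
def IsUnicyclicCaterpillar {V : Type*} (H : SimpleGraph V) : Prop :=
  H.Connected ∧ H.edgeSet.ncard = Nat.card V ∧
  (H.induce {v | 2 ≤ (H.neighborSet v).ncard}).Connected ∧
  ∀ v, ((H.induce {v | 2 ≤ (H.neighborSet v).ncard}).neighborSet v).ncard = 2

/-- A nest of `Γ^r_n`: an exact spanning subgraph of maximum degree at most 3 each of
whose connected components is a unicyclic caterpillar. -/
def HasNest (n r : ℕ) : Prop :=
  ∃ Ψ : SimpleGraph {A : Finset (Fin n) // A.card = r},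
    Ψ ≤ johnson n r ∧ IsExact Ψ ∧ (∀ v, (Ψ.neighborSet v).ncard ≤ 3) ∧
    ∀ c : Ψ.ConnectedComponent, IsUnicyclicCaterpillar (Ψ.induce c.supp)

/-- `P_r` from Theorem 7 of the paper. -/
def Pnum (r : ℕ) : ℕ :=
  if r % 2 = 1 then Nat.choose (2 * r) r - 2 ^ r
  else Nat.choose (2 * r) r - 2 ^ r - Nat.choose r (r / 2)

/-- The Young subgroup `H = S_{{1,…,r}} × S_{{r+1,…,n}}` as a subset of `S_{r+t}`. -/
def youngH (r t : ℕ) : Set (Equiv.Perm (Fin (r + t))) :=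
  {σ | (⇑σ) '' {i : Fin (r + t) | (i : ℕ) < r} = {i : Fin (r + t) | (i : ℕ) < r}}

/-- The edges from a cyclically ordered vertex list. -/
def cycleEdges {α : Type*} (l : List α) : List (α × α) := l.zip (l.rotate 1)


open Equiv in
/-- The colour (residue modulo `r`) of the position at which `σ` takes the value `x`. -/
def col {r : ℕ} (σ : Perm (Fin (r + r))) (x : Fin (r + r)) : Fin r :=
  ⟨(σ⁻¹ x).val % r, Nat.mod_lt _ (by have := x.2; omega)⟩

open Equiv in
/-- `σ` is transversal if values of the same type (below `r`, or at least `r`) sit at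
positions with distinct residues modulo `r`. -/
def IsTransversal {r : ℕ} (σ : Perm (Fin (r + r))) : Prop :=
  ∀ x y : Fin (r + r), (x.val < r ↔ y.val < r) → col σ x = col σ y → x = y

section Transversal

open Equiv

variable {r : ℕ} {σ τ : Perm (Fin (r + r))} {x y : Fin (r + r)}

lemma col_swap_mul (σ : Perm (Fin (r + r))) (x y z : Fin (r + r)) :
    col (swap x y * σ) z = col σ (swap x y z) := by
  simp [col, mul_inv_rev]

lemma col_apply (σ : Perm (Fin (r + r))) (p : Fin (r + r)) : (col σ (σ p)).val = p.val % r := by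
  simp [col]

lemma isTransversal_iff (σ : Perm (Fin (r + r))) :
    IsTransversal σ ↔ ∀ i : Fin r,
      ¬ ((σ (Fin.castAdd r i)).val < r ↔ (σ (Fin.natAdd r i)).val < r) := by
  constructor
  · intro H i hx
    have := H _ _ hx (by ext; simp [col_apply])
    have := congrArg Fin.val (σ.injective this)
    simp only [Fin.val_castAdd, Fin.val_natAdd] at this
    omega
  · intro H x y hxy hc
    obtain ⟨p, rfl⟩ := σ.surjective x
    obtain ⟨q, rfl⟩ := σ.surjective y
    have hc' := congrArg Fin.val hc
    rw [col_apply, col_apply] at hc'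
    have key : ∀ p q : Fin (r + r), p.val % r = q.val % r → p.val < q.val →
        ¬ ((σ p).val < r ↔ (σ q).val < r) := by
      intro p q hpq hlt
      have hq := q.2
      have hpr : p.val < r := by
        by_contra hp
        rw [Nat.mod_eq_sub_mod (by omega), Nat.mod_eq_sub_mod (a := q.val) (by omega),
          Nat.mod_eq_of_lt (by omega), Nat.mod_eq_of_lt (by omega)] at hpq
        omega
      have hqr : r ≤ q.val := by
        by_contra hq
        rw [Nat.mod_eq_of_lt (by omega), Nat.mod_eq_of_lt (by omega)] at hpq
        omega
      rw [Nat.mod_eq_of_lt hpr, Nat.mod_eq_sub_mod hqr, Nat.mod_eq_of_lt (by omega)] at hpq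
      have h := H ⟨p.val, hpr⟩
      have hq' : Fin.natAdd r ⟨p.val, hpr⟩ = q := Fin.ext (by simp; omega)
      rwa [hq'] at h
    rcases lt_trichotomy p.val q.val with h | h | h
    · exact absurd hxy (key p q hc' h)
    · rw [Fin.ext h]
    · exact absurd hxy.symm (key q p hc'.symm h)

lemma lt_swap_iff (hxy : x.val < r ↔ y.val < r) (z : Fin (r + r)) :
    (swap x y z).val < r ↔ z.val < r := by
  rcases eq_or_ne z x with rfl | hx
  · simp [hxy]
  rcases eq_or_ne z y with rfl | hy
  · simp [hxy]
  rw [swap_apply_of_ne_of_ne hx hy]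

lemma IsTransversal.swap_mul (hσ : IsTransversal σ) (hxy : x.val < r ↔ y.val < r) :
    IsTransversal (swap x y * σ) := by
  intro z w hzw hc
  rw [col_swap_mul, col_swap_mul] at hc
  exact (swap x y).injective (hσ _ _ (by rwa [lt_swap_iff hxy, lt_swap_iff hxy]) hc)

lemma col_swap_mul_of_col_eq (hxy : col σ x = col σ y) : col (swap x y * σ) = col σ := by
  ext1 z
  rw [col_swap_mul]
  rcases eq_or_ne z x with rfl | hx
  · simp [hxy]
  rcases eq_or_ne z y with rfl | hy
  · simp [hxy]
  rw [swap_apply_of_ne_of_ne hx hy]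

lemma IsTransversal.swap_mul_of_col_eq (hσ : IsTransversal σ) (hxy : col σ x = col σ y) :
    IsTransversal (swap x y * σ) := by
  intro z w hzw hc
  rw [col_swap_mul_of_col_eq hxy] at hc
  exact hσ z w hzw hc

/-- In a transversal permutation, each colour is attained by a value of the type opposite to
that of a given value of this colour. -/
lemma IsTransversal.exists_partner (hσ : IsTransversal σ) (x : Fin (r + r)) :
    ∃ y, col σ y = col σ x ∧ ¬ (y.val < r ↔ x.val < r) := by
  have h := (isTransversal_iff σ).1 hσ (col σ x)
  have h1 : col σ (σ (Fin.castAdd r (col σ x))) = col σ x :=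
    Fin.ext (by rw [col_apply]; exact Nat.mod_eq_of_lt (col σ x).2)
  have h2 : col σ (σ (Fin.natAdd r (col σ x))) = col σ x :=
    Fin.ext (by rw [col_apply]; simp [Nat.mod_eq_of_lt (col σ x).2])
  by_cases hx : (σ (Fin.castAdd r (col σ x))).val < r ↔ x.val < r
  · exact ⟨_, h2, fun h' => h (hx.trans h'.symm)⟩
  · exact ⟨_, h1, hx⟩

/-- The sign of the arrangement of the columns of the values at least `r` (as a determinant),
times the sign of `σ`. -/
def parity (σ : Perm (Fin (r + r))) : ℤ :=
  (Perm.sign σ : ℤ) *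
    ((1 : Matrix (Fin r) (Fin r) ℤ).submatrix (fun i => col σ (Fin.natAdd r i)) id).det

lemma parity_swap_of_lt (hne : x ≠ y) (hx : x.val < r) (hy : y.val < r) :
    parity (swap x y * σ) = - parity σ := by
  have : (fun i => col (swap x y * σ) (Fin.natAdd r i)) = fun i => col σ (Fin.natAdd r i) := by
    ext1 i
    rw [col_swap_mul, swap_apply_of_ne_of_ne] <;>
    · rintro rfl
      simp at hx hy
  rw [parity, this, parity]
  simp [Perm.sign_swap hne]

lemma parity_swap_of_col_eq (hne : x ≠ y) (hxy : col σ x = col σ y) :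
    parity (swap x y * σ) = - parity σ := by
  simp [parity, col_swap_mul_of_col_eq hxy, Perm.sign_swap hne]

lemma parity_swap_of_le (hne : x ≠ y) (hx : r ≤ x.val) (hy : r ≤ y.val) :
    parity (swap x y * σ) = parity σ := by
  obtain ⟨i, rfl⟩ : ∃ i, Fin.natAdd r i = x := ⟨⟨x - r, by omega⟩, Fin.ext (by simp; omega)⟩
  obtain ⟨j, rfl⟩ : ∃ j, Fin.natAdd r j = y := ⟨⟨y - r, by omega⟩, Fin.ext (by simp; omega)⟩
  have hij : i ≠ j := fun h => hne (by rw [h])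
  have : (fun k => col (swap (Fin.natAdd r i) (Fin.natAdd r j) * σ) (Fin.natAdd r k)) =
      (fun k => col σ (Fin.natAdd r k)) ∘ swap i j := by
    ext1 k
    rw [col_swap_mul, Function.comp_apply, (Fin.natAdd_injective r r).swap_apply]
  have h := Matrix.det_permute (swap i j)
    ((1 : Matrix (Fin r) (Fin r) ℤ).submatrix (fun k => col σ (Fin.natAdd r k)) id)
  rw [Matrix.submatrix_submatrix, Function.id_comp] at h
  rw [parity, this, h, parity, Perm.sign_mul, Perm.sign_swap hne, Perm.sign_swap hij]
  simp

lemma IsTransversal.parity_eq (hσ : IsTransversal σ) : parity σ = 1 ∨ parity σ = -1 := by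
  have hinj : Function.Injective (fun i => col σ (Fin.natAdd r i)) := fun i j h =>
    Fin.natAdd_injective r r (hσ _ _ (by simp) h)
  have h := Matrix.det_permute (Equiv.ofBijective _ (Finite.injective_iff_bijective.1 hinj))
    (1 : Matrix (Fin r) (Fin r) ℤ)
  rw [Equiv.coe_ofBijective, Matrix.det_one, mul_one] at h
  rw [parity, h, Int.cast_id, ← Units.val_mul]
  rcases Int.units_eq_one_or (Perm.sign σ * Perm.sign (Equiv.ofBijective _
    (Finite.injective_iff_bijective.1 hinj))) with h | h <;> rw [h] <;> decide

/-- The edges of `X³_{r,r}`, with centers `a = r - 1` and `b = r`. -/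
lemma X3_adj_iff {a b : Fin (r + r)} (ha : a.val = r - 1) (hb : b.val = r)
    (σ τ : Perm (Fin (r + r))) : (X3 r r).Adj σ τ ↔
      (∃ i, i.val < r ∧ i ≠ a ∧ τ = swap i a * σ) ∨ τ = swap a b * σ ∨
        (∃ j, r ≤ j.val ∧ j ≠ b ∧ τ = swap j b * σ) := by
  have hr := b.2
  have hab : a ≠ b := fun h => by rw [h] at ha; omega
  have hE : ∀ i j, (doubleStar r r).Adj i j ∧ τ * σ⁻¹ = swap i j →
      (∃ i, i.val < r ∧ i ≠ a ∧ τ = swap i a * σ) ∨ τ = swap a b * σ ∨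
        (∃ j, r ≤ j.val ∧ j ≠ b ∧ τ = swap j b * σ) := by
    rintro i j ⟨hij, h⟩
    rw [mul_inv_eq_iff_eq_mul] at h
    have key : ∀ i j : Fin (r + r), τ = swap i j * σ →
        ((i : ℕ) < r - 1 ∧ (j : ℕ) = r - 1) ∨ ((i : ℕ) = r - 1 ∧ (j : ℕ) = r) ∨
          ((i : ℕ) = r ∧ r < (j : ℕ)) →
        (∃ i, i.val < r ∧ i ≠ a ∧ τ = swap i a * σ) ∨ τ = swap a b * σ ∨
        (∃ j, r ≤ j.val ∧ j ≠ b ∧ τ = swap j b * σ) := by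
      rintro i j h (⟨h1, h2⟩ | ⟨h1, h2⟩ | ⟨h1, h2⟩)
      · obtain rfl : j = a := Fin.ext (by omega)
        exact .inl ⟨i, by omega, fun h => by rw [h] at h1; omega, h⟩
      · obtain rfl : i = a := Fin.ext (by omega)
        obtain rfl : j = b := Fin.ext (by omega)
        exact .inr (.inl h)
      · obtain rfl : i = b := Fin.ext (by omega)
        exact .inr (.inr ⟨j, by omega, fun h => by rw [h] at h2; omega, by rwa [swap_comm]⟩)
    rcases hij.2 with h' | h'
    · exact key i j h h'
    · exact key j i (by rwa [swap_comm]) h'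
  have hmk : ∀ i j, (doubleStar r r).Adj i j → τ = swap i j * σ → (X3 r r).Adj σ τ := by
    rintro i j hij rfl
    refine ⟨?_, .inl ⟨i, j, hij, by simp⟩⟩
    intro h
    exact hij.1 (swap_eq_one_iff.1 (mul_eq_right.1 h.symm))
  constructor
  · rintro ⟨-, ⟨i, j, h⟩ | ⟨i, j, h1, h2⟩⟩
    · exact hE i j h
    · refine hE i j ⟨h1, ?_⟩
      rw [← swap_inv, ← h2]
      simp
  · rintro (⟨i, hi, hne, h⟩ | h | ⟨j, hj, hne, h⟩)
    · refine hmk i a ⟨hne, .inl (.inl ⟨?_, ha⟩)⟩ h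
      have : i.val ≠ a.val := fun h => hne (Fin.ext h)
      omega
    · exact hmk a b ⟨hab, .inl (.inr (.inl ⟨ha, hb⟩))⟩ h
    · refine hmk j b ⟨hne, .inr (.inr (.inr ⟨hb, ?_⟩))⟩ h
      have : j.val ≠ b.val := fun h => hne (Fin.ext h)
      omega

theorem exists_isEDSOn_isTransversal (hr : 0 < r) :
    ∃ J : Set (Perm (Fin (r + r))), IsEDSOn (X3 r r) {σ | IsTransversal σ} J := by
  obtain ⟨a, ha⟩ : ∃ a : Fin (r + r), a.val = r - 1 := ⟨⟨r - 1, by omega⟩, rfl⟩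
  obtain ⟨b, hb⟩ : ∃ b : Fin (r + r), b.val = r := ⟨⟨r, by omega⟩, rfl⟩
  have hab : a ≠ b := fun h => by rw [h] at ha; omega
  have hcol_lt : ∀ (σ : Perm (Fin (r + r))) (i : Fin (r + r)), i.val < r →
      (col (swap i a * σ) a = col (swap i a * σ) b ↔ col σ i = col σ b) := by
    intro σ i hi
    have hib : b ≠ i := fun h => by rw [← h] at hi; omega
    rw [col_swap_mul, col_swap_mul, swap_apply_right, swap_apply_of_ne_of_ne hib hab.symm]
  have hcol_le : ∀ (σ : Perm (Fin (r + r))) (j : Fin (r + r)), r ≤ j.val →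
      (col (swap j b * σ) a = col (swap j b * σ) b ↔ col σ j = col σ a) := by
    intro σ j hj
    have hja : a ≠ j := fun h => by rw [← h] at hj; omega
    rw [col_swap_mul, col_swap_mul, swap_apply_right, swap_apply_of_ne_of_ne hja hab, eq_comm]
  refine ⟨{σ | IsTransversal σ ∧ col σ a = col σ b ∧ parity σ = 1}, fun σ h => h.1, ?_, ?_⟩
  · rintro u ⟨hu, hum, huc⟩ v ⟨hv, hvm, hvc⟩ hadj
    rcases (X3_adj_iff ha hb u v).1 hadj with ⟨i, hi, hne, rfl⟩ | rfl | ⟨j, hj, hne, rfl⟩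
    · rw [hcol_lt u i hi, ← hum] at hvm
      exact hne (hu _ _ (by omega) hvm)
    · rw [parity_swap_of_col_eq hab hum] at hvc
      omega
    · rw [hcol_le u j hj, hum] at hvm
      exact hne (hu _ _ (by omega) hvm)
  · intro v hv hvJ
    by_cases hm : col v a = col v b
    · have hc : parity v = -1 := hv.parity_eq.resolve_left fun h => hvJ ⟨hv, hm, h⟩
      refine ⟨swap a b * v, ⟨⟨hv.swap_mul_of_col_eq hm, ?_, ?_⟩, ?_⟩, ?_⟩
      · rw [col_swap_mul_of_col_eq hm, hm]
      · rw [parity_swap_of_col_eq hab hm, hc, neg_neg]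
      · exact (X3_adj_iff ha hb _ _).2 (.inr (.inl rfl))
      · rintro u ⟨⟨-, hum, -⟩, hadj⟩
        rcases (X3_adj_iff ha hb v u).1 hadj with ⟨i, hi, hne, rfl⟩ | rfl | ⟨j, hj, hne, rfl⟩
        · rw [hcol_lt v i hi, ← hm] at hum
          exact absurd (hv _ _ (by omega) hum) hne
        · rfl
        · rw [hcol_le v j hj, hm] at hum
          exact absurd (hv _ _ (by omega) hum) hne
    · obtain ⟨i, hic, hi⟩ := hv.exists_partner b
      obtain ⟨j, hjc, hj⟩ := hv.exists_partner a
      have hi' : i.val < r := by omega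
      have hj' : r ≤ j.val := by omega
      have hia : i ≠ a := fun h => hm (by rw [← hic, h])
      have hjb : j ≠ b := fun h => hm (by rw [← hjc, h])
      have hpi := parity_swap_of_lt (σ := v) hia hi' (by omega)
      have hpj := parity_swap_of_le (σ := v) hjb hj' hb.ge
      have huniq : ∀ u, IsTransversal u → col u a = col u b → (X3 r r).Adj v u →
          u = swap i a * v ∨ u = swap j b * v := by
        intro u hu hum hadj
        rcases (X3_adj_iff ha hb v u).1 hadj with ⟨k, hk, hne, rfl⟩ | rfl | ⟨k, hk, hne, rfl⟩
        · rw [hcol_lt v k hk, ← hic] at hum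
          rw [hv _ _ (by omega) hum]
          exact .inl rfl
        · rw [col_swap_mul, col_swap_mul, swap_apply_left, swap_apply_right] at hum
          exact absurd hum.symm hm
        · rw [hcol_le v k hk, ← hjc] at hum
          rw [hv _ _ (by omega) hum]
          exact .inr rfl
      rcases hv.parity_eq with hc | hc
      · refine ⟨swap j b * v, ⟨⟨hv.swap_mul (by omega), ?_, by rw [hpj, hc]⟩, ?_⟩, ?_⟩
        · exact (hcol_le v j hj').2 hjc
        · exact (X3_adj_iff ha hb _ _).2 (.inr (.inr ⟨j, hj', hjb, rfl⟩))
        · rintro u ⟨⟨hu, hum, huc⟩, hadj⟩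
          refine (huniq u hu hum hadj).resolve_left ?_
          rintro rfl
          omega
      · refine ⟨swap i a * v, ⟨⟨hv.swap_mul (by omega), ?_, by rw [hpi, hc, neg_neg]⟩, ?_⟩, ?_⟩
        · exact (hcol_lt v i hi').2 hic
        · exact (X3_adj_iff ha hb _ _).2 (.inl ⟨i, hi', hia, rfl⟩)
        · rintro u ⟨⟨hu, hum, huc⟩, hadj⟩
          refine (huniq u hu hum hadj).resolve_right ?_
          rintro rfl
          omega

/-- If `σ` is transversal, then so is `τ`, and `τ` is reachable from `σ` in the subgraph of
`X³_{r,r}` induced on the transversal permutations. -/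
def TransReach (σ τ : Perm (Fin (r + r))) : Prop :=
  ∀ hσ : IsTransversal σ, ∃ hτ : IsTransversal τ,
    ((X3 r r).induce {σ | IsTransversal σ}).Reachable ⟨σ, hσ⟩ ⟨τ, hτ⟩

lemma TransReach.refl (σ : Perm (Fin (r + r))) : TransReach σ σ := fun hσ => ⟨hσ, .rfl⟩

lemma TransReach.trans {ρ : Perm (Fin (r + r))} (h₁ : TransReach σ τ) (h₂ : TransReach τ ρ) :
    TransReach σ ρ := fun hσ =>
  have ⟨hτ, h⟩ := h₁ hσ
  have ⟨hρ, h'⟩ := h₂ hτ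
  ⟨hρ, h.trans h'⟩

lemma TransReach.of_adj (h : (X3 r r).Adj σ τ) (hτ : IsTransversal σ → IsTransversal τ) :
    TransReach σ τ := fun hσ => ⟨hτ hσ, SimpleGraph.Adj.reachable h⟩

lemma transReach_swap_of_adj {c : Fin (r + r)}
    (hadj : ∀ (x : Fin (r + r)) (σ : Perm (Fin (r + r))), (x.val < r ↔ c.val < r) → x ≠ c →
      (X3 r r).Adj σ (swap x c * σ))
    (σ : Perm (Fin (r + r))) (hx : x.val < r ↔ c.val < r) (hy : y.val < r ↔ c.val < r) :
    TransReach σ (swap x y * σ) := by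
  have hc : ∀ (x : Fin (r + r)) (σ : Perm (Fin (r + r))), (x.val < r ↔ c.val < r) →
      TransReach σ (swap x c * σ) := by
    intro x σ hx
    rcases eq_or_ne x c with rfl | hne
    · rw [swap_self]
      exact .refl σ
    · exact .of_adj (hadj x σ hx hne) fun h => h.swap_mul hx
  rcases eq_or_ne x y with rfl | hxy
  · rw [swap_self]
    exact .refl σ
  rcases eq_or_ne x c with rfl | hxc
  · rw [swap_comm]
    exact hc y σ hy
  rcases eq_or_ne y c with rfl | hyc
  · exact hc x σ hx
  have h := ((hc x σ hx).trans (hc y _ hy)).trans (hc x _ hx)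
  have e := swap_apply_apply (swap x c) c y
  rw [swap_apply_of_ne_of_ne hxy.symm hyc, swap_apply_right, swap_inv, swap_comm c y] at e
  rwa [← mul_assoc, ← mul_assoc, ← e] at h

lemma transReach_swap (hxy : x.val < r ↔ y.val < r) (σ : Perm (Fin (r + r))) :
    TransReach σ (swap x y * σ) := by
  have hr := x.2
  obtain ⟨a, ha⟩ : ∃ a : Fin (r + r), a.val = r - 1 := ⟨⟨r - 1, by omega⟩, rfl⟩
  obtain ⟨b, hb⟩ : ∃ b : Fin (r + r), b.val = r := ⟨⟨r, by omega⟩, rfl⟩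
  by_cases hx : x.val < r
  · refine transReach_swap_of_adj (c := a) (fun x σ hx hne => ?_) σ (by omega) (by omega)
    exact (X3_adj_iff ha hb _ _).2 (.inl ⟨x, by omega, hne, rfl⟩)
  · refine transReach_swap_of_adj (c := b) (fun x σ hx hne => ?_) σ (by omega) (by omega)
    exact (X3_adj_iff ha hb _ _).2 (.inr (.inr ⟨x, by omega, hne, rfl⟩))

lemma transReach_swap_of_lt_of_le (hx : x.val < r) (hy : r ≤ y.val) (hxy : col σ x = col σ y) :
    TransReach σ (swap x y * σ) := by
  obtain ⟨a, ha⟩ : ∃ a : Fin (r + r), a.val = r - 1 := ⟨⟨r - 1, by omega⟩, rfl⟩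
  obtain ⟨b, hb⟩ : ∃ b : Fin (r + r), b.val = r := ⟨⟨r, by omega⟩, rfl⟩
  have hne : ∀ u v : Fin (r + r), u.val < r → r ≤ v.val → u ≠ v := fun u v hu hv h => by
    rw [h] at hu; omega
  have hxa : x.val < r ↔ a.val < r := by omega
  have hyb : y.val < r ↔ b.val < r := by omega
  have h1 := (transReach_swap hxa σ).trans (transReach_swap hyb _)
  have hc : col (swap y b * (swap x a * σ)) a = col (swap y b * (swap x a * σ)) b := by
    rw [col_swap_mul, col_swap_mul, col_swap_mul, col_swap_mul,
      swap_apply_of_ne_of_ne (hne a y (by omega) hy) (hne a b (by omega) hb.ge),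
      swap_apply_right, swap_apply_right,
      swap_apply_of_ne_of_ne (hne x y hx hy).symm (hne a y (by omega) hy).symm, hxy]
  have h2 := h1.trans (.of_adj ((X3_adj_iff ha hb _ _).2 (.inr (.inl rfl)))
    fun h => h.swap_mul_of_col_eq hc)
  have h3 := (h2.trans (transReach_swap hyb _)).trans (transReach_swap hxa _)
  have e : swap x a * (swap y b * (swap a b * (swap y b * (swap x a * σ)))) =
      swap x y * σ := by
    have e1 : swap y b * swap a b * swap y b = swap a y := by
      have := swap_apply_apply (swap y b) a b
      rw [swap_apply_of_ne_of_ne (hne a y (by omega) hy) (hne a b (by omega) hb.ge),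
        swap_apply_right, swap_inv] at this
      exact this.symm
    have e2 : swap x a * swap a y * swap x a = swap x y := by
      have := swap_apply_apply (swap x a) a y
      rw [swap_apply_of_ne_of_ne (hne x y hx hy).symm (hne a y (by omega) hy).symm,
        swap_apply_right, swap_inv] at this
      exact this.symm
    rw [← e2, ← e1]
    simp only [mul_assoc]
  rwa [e] at h3

lemma transReach_swap_of_col_eq (hxy : col σ x = col σ y) : TransReach σ (swap x y * σ) := by
  by_cases hx : x.val < r <;> by_cases hy : y.val < r
  · exact transReach_swap (by omega) σ
  · exact transReach_swap_of_lt_of_le hx (by omega) hxy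
  · rw [swap_comm]
    exact transReach_swap_of_lt_of_le hy (by omega) hxy.symm
  · exact transReach_swap (by omega) σ

/-- A wrong position can be corrected without spoiling the right ones. -/
lemma exists_transReach_agree (hσ : IsTransversal σ) (hτ : IsTransversal τ)
    (p : Fin (r + r)) (hp : σ p ≠ τ p) :
    ∃ ρ, TransReach σ ρ ∧ ρ p = τ p ∧ ∀ q, σ q = τ q → ρ q = τ q := by
  by_cases ht : (σ p).val < r ↔ (τ p).val < r
  · refine ⟨swap (σ p) (τ p) * σ, transReach_swap ht σ, by simp, fun q hq => ?_⟩
    have hqp : q ≠ p := by rintro rfl; exact hp hq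
    rw [Perm.mul_apply, swap_apply_of_ne_of_ne (σ.injective.ne hqp) (hq ▸ τ.injective.ne hqp), hq]
  · obtain ⟨x, hx, hxt⟩ := hσ.exists_partner (σ p)
    obtain ⟨p', rfl⟩ := σ.surjective x
    have hp' : σ p' ≠ τ p' := by
      intro h
      have hc : col τ (τ p') = col τ (τ p) := by
        have := congrArg Fin.val hx
        rw [col_apply, col_apply] at this
        exact Fin.ext (by rw [col_apply, col_apply, this])
      have : τ p' = τ p := hτ _ _ (by rw [← h]; tauto) hc
      rw [τ.injective this] at hxt
      exact hxt Iff.rfl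
    refine ⟨swap (σ p') (τ p) * (swap (σ p) (σ p') * σ),
      (transReach_swap_of_col_eq hx.symm).trans (transReach_swap (by tauto) _), by simp,
      fun q hq => ?_⟩
    have hqp : q ≠ p := by rintro rfl; exact hp hq
    have hqp' : q ≠ p' := by rintro rfl; exact hp' hq
    rw [Perm.mul_apply, Perm.mul_apply,
      swap_apply_of_ne_of_ne (σ.injective.ne hqp) (σ.injective.ne hqp'),
      swap_apply_of_ne_of_ne (σ.injective.ne hqp') (hq ▸ τ.injective.ne hqp), hq]

lemma IsTransversal.transReach (hσ : IsTransversal σ) (hτ : IsTransversal τ) :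
    TransReach σ τ := by
  induction hd : (Finset.univ.filter fun p => σ p ≠ τ p).card using Nat.strong_induction_on
    generalizing σ with
  | _ d ih =>
    by_cases h : σ = τ
    · exact h ▸ .refl σ
    · obtain ⟨p, hp⟩ : ∃ p, σ p ≠ τ p := by
        by_contra! h'
        exact h (Equiv.ext h')
      obtain ⟨ρ, hρ, hρp, hρq⟩ := exists_transReach_agree hσ hτ p hp
      refine hρ.trans (ih _ ?_ (hρ hσ).1 rfl)
      rw [← hd]
      refine Finset.card_lt_card (Finset.ssubset_iff_of_subset ?_ |>.2 ⟨p, by simpa using hp,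
        by simpa using hρp⟩)
      intro q hq
      simp only [Finset.mem_filter, Finset.mem_univ, true_and] at hq ⊢
      exact fun h => hq (hρq q h)

theorem connected_induce_isTransversal :
    ((X3 r r).induce {σ | IsTransversal σ}).Connected := by
  have hone : IsTransversal (1 : Perm (Fin (r + r))) := by
    rw [isTransversal_iff]
    intro i
    simp
  have : Nonempty {σ : Perm (Fin (r + r)) | IsTransversal σ} := ⟨1, hone⟩
  refine ⟨fun u v => ?_⟩
  exact (u.2.transReach v.2 u.2).2

end Transversal

/-- for `r ≥ 3`, the subgraph of `X³_{r,r}` induced on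
`V' = {σ | for each i ≤ r, exactly one of i, r+i lies in σ⁻¹({1,…,r})}` is connected and
admits an efficient dominating set. -/
theorem Xprime_connected_and_has_EDS (r : ℕ) (hr : 3 ≤ r)
    (V' : Set (Equiv.Perm (Fin (r + r))))
    (hV' : V' = {σ | ∀ i : ℕ, ∀ h : i < r,
      Xor' ((σ ⟨i, by omega⟩ : Fin (r + r)).val < r)
        ((σ ⟨r + i, by omega⟩ : Fin (r + r)).val < r)}) :
    ((X3 r r).induce V').Connected ∧ ∃ J : Set (Equiv.Perm (Fin (r + r))),
      IsEDSOn (X3 r r) V' J := by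
  have hV : V' = {σ | IsTransversal σ} := by
    rw [hV']
    ext σ
    refine Iff.trans ?_ (isTransversal_iff σ).symm
    exact ⟨fun h i => (xor_iff_not_iff _ _).1 (h i.1 i.2),
      fun h i hi => (xor_iff_not_iff _ _).2 (h ⟨i, hi⟩)⟩
  subst hV
  exact ⟨connected_induce_isTransversal, exists_isEDSOn_isTransversal (by omega)⟩
end

section
/- Let r ≥ 3 and n = 2r. There exists a 1-sphere packing J of X³_{r,r} such that the union of the closed neighborhoods N[v], v ∈ J, has cardinality exactly 2^r (r!)² + 2 P_r (r−1)! r!; equivalently, |J| = (2^r (r!)² + 2 P_r (r−1)! r!)/(2r). -/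
namespace DoubleStar

open Equiv Finset

/-- The identity together with the transpositions along the edges of a double star on `ι ⊕ ι`
whose centers are `inl a` and `inr b`; the identity is `move a b (inl a)`. -/
def move {ι : Type*} [DecidableEq ι] (a b : ι) : ι ⊕ ι → Perm (ι ⊕ ι)
  | .inl i => swap (.inl a) (.inl i)
  | .inr j => if j = b then swap (.inl a) (.inr b) else swap (.inr b) (.inr j)

/-- A set of words is separated if the words reached by a single move from distinct members are
distinct. -/
def IsSeparated {ι β : Type*} [DecidableEq ι] (a b : ι) (C : Set (ι ⊕ ι ≃ β)) : Prop :=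
  ∀ p ∈ C, ∀ q ∈ C, ∀ x y, (move a b x).trans p = (move a b y).trans q → p = q

/-- The set of symbols that a word carries at its left positions. -/
def leftSet {ι β : Type*} [Fintype ι] [DecidableEq β] (p : ι ⊕ ι ≃ β) : Finset β :=
  univ.image fun i => p (.inl i)

/-- The word whose left and right halves list the transversals `{(k, ε k)}` and `{(k, -ε k)}` in
the orders given by `u` and `v`. -/
def transversalWord {ι : Type*} [DecidableEq ι] (ε : ι → ℤˣ) (u v : Perm ι) :
    ι ⊕ ι ≃ ι × ℤˣ where
  toFun := Sum.elim (fun i => (u i, ε (u i))) (fun j => (v j, -ε (v j)))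
  invFun z := if z.2 = ε z.1 then .inl (u.symm z.1) else .inr (v.symm z.1)
  left_inv := by
    rintro (i | j)
    · simp
    · have : -ε (v j) ≠ ε (v j) := by
        rcases Int.units_eq_one_or (ε (v j)) with h | h <;> rw [h] <;> decide
      simp [this]
  right_inv := by
    rintro ⟨k, e⟩
    by_cases h : e = ε k
    · simp [h]
    · have : -ε k = e := by
        rcases Int.units_eq_one_or (ε k) with h1 | h1 <;>
          rcases Int.units_eq_one_or e with h2 | h2 <;> simp_all
      simp [h, this]

/-- The words on complementary transversals whose centers carry partners `(k, ε k)`, `(k, -ε k)`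
and whose left half has sign `∏ k, ε k`. -/
def transversalCode {ι : Type*} [Fintype ι] [DecidableEq ι] (a b : ι) : Set (ι ⊕ ι ≃ ι × ℤˣ) :=
  {p | ∃ ε u v, v b = u a ∧ Perm.sign u = ∏ k, ε k ∧ p = transversalWord ε u v}

/-- The `ι`-sized sets of symbols containing some pair `(k, 1)`, `(k, -1)` and meeting another such
pair in exactly one symbol. -/
def IsMixed {ι : Type*} [Fintype ι] (A : Finset (ι × ℤˣ)) : Prop :=
  A.card = Fintype.card ι ∧ (∃ k, (k, 1) ∈ A ∧ (k, -1) ∈ A) ∧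
    ∃ k, ((k, 1) ∈ A ∧ (k, -1) ∉ A) ∨ ((k, 1) ∉ A ∧ (k, -1) ∈ A)

/-- The symbols `x ∈ A` and `y ∉ A` allowed at the centers of a word with left set `A`. -/
def CenterRule {ι : Type*} (A : Finset (ι × ℤˣ)) (x y : ι × ℤˣ) : Prop :=
  (∃ f s, (f, 1) ∈ A ∧ (f, -1) ∈ A ∧ (s, 1) ∈ A ∧ (s, -1) ∉ A ∧ x = (f, 1) ∧ y = (s, -1)) ∨
    ((∀ s, (s, 1) ∈ A → (s, -1) ∈ A) ∧
      ∃ s e, (s, -1) ∈ A ∧ (s, 1) ∉ A ∧ (e, 1) ∉ A ∧ (e, -1) ∉ A ∧ x = (s, -1) ∧ y = (e, 1))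

/-- The words with a mixed left set whose centers carry the symbols prescribed by `c`. -/
def mixedCode {ι : Type*} [Fintype ι] [DecidableEq ι] (a b : ι)
    (c : Finset (ι × ℤˣ) → (ι × ℤˣ) × (ι × ℤˣ)) : Set (ι ⊕ ι ≃ ι × ℤˣ) :=
  {p | IsMixed (leftSet p) ∧ p (.inl a) = (c (leftSet p)).1 ∧ p (.inr b) = (c (leftSet p)).2}

theorem trans_left_cancel {α β γ : Type*} {e : α ≃ β} {f g : β ≃ γ} (h : e.trans f = e.trans g) :
    f = g := by
  rwa [trans_cancel_left, ← trans_assoc, symm_trans_self, refl_trans] at h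

section Moves

variable {ι β : Type*} [DecidableEq ι] {a b : ι}

theorem move_inl (i : ι) : move a b (.inl i) = swap (.inl a) (.inl i) := rfl

theorem move_inr_self : move a b (.inr b) = swap (.inl a) (.inr b) := by simp [move]

theorem move_inr_of_ne {j : ι} (h : j ≠ b) : move a b (.inr j) = swap (.inr b) (.inr j) := by
  simp [move, h]

theorem move_eq_swap (x : ι ⊕ ι) : ∃ y z, move a b x = swap y z := by
  rcases x with i | j
  · exact ⟨_, _, rfl⟩
  · by_cases h : j = b
    · exact ⟨_, _, by rw [h, move_inr_self]⟩
    · exact ⟨_, _, move_inr_of_ne h⟩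

theorem move_symm (x : ι ⊕ ι) : (move a b x).symm = move a b x := by
  obtain ⟨y, z, h⟩ := move_eq_swap (a := a) (b := b) x
  rw [h, symm_swap]

/-- A move is determined by its action on the two centers. -/
theorem move_ext {x y : ι ⊕ ι} (ha : move a b x (.inl a) = move a b y (.inl a))
    (hb : move a b x (.inr b) = move a b y (.inr b)) : x = y := by
  have key (x : ι ⊕ ι) : x = (if move a b x (.inl a) = .inr b then .inr b else
      if move a b x (.inr b) = .inr b then move a b x (.inl a) else move a b x (.inr b)) := by
    rcases x with i | j
    · simp [move_inl, swap_apply_of_ne_of_ne]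
    · by_cases h : j = b
      · simp [h, move_inr_self]
      · simp [move_inr_of_ne h, swap_apply_of_ne_of_ne, h]
  rw [key x, key y, ha, hb]

theorem move_injective : Function.Injective (move a b) := fun x y h =>
  move_ext (by rw [h]) (by rw [h])

variable [Fintype ι] [DecidableEq β]

theorem mem_leftSet {ι β : Type*} [Fintype ι] [DecidableEq β] {p : ι ⊕ ι ≃ β} {y : β} :
    y ∈ leftSet p ↔ ∃ i, p (.inl i) = y := by
  simp [leftSet]

theorem inl_mem_leftSet {ι β : Type*} [Fintype ι] [DecidableEq β] (p : ι ⊕ ι ≃ β)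
    (i : ι) : p (.inl i) ∈ leftSet p :=
  mem_leftSet.2 ⟨i, rfl⟩

theorem inr_notMem_leftSet {ι β : Type*} [Fintype ι] [DecidableEq β] (p : ι ⊕ ι ≃ β)
    (j : ι) : p (.inr j) ∉ leftSet p := by
  simp [mem_leftSet]

theorem mem_leftSet_iff_isLeft {ι β : Type*} [Fintype ι] [DecidableEq β] {p : ι ⊕ ι ≃ β}
    {z : ι ⊕ ι} : p z ∈ leftSet p ↔ z.isLeft := by
  rcases z with i | j
  · simp [inl_mem_leftSet]
  · simp [inr_notMem_leftSet]

theorem leftSet_move_trans (p : ι ⊕ ι ≃ β) {x : ι ⊕ ι} (hx : x ≠ .inr b) :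
    leftSet ((move a b x).trans p) = leftSet p := by
  ext y
  obtain ⟨z, rfl⟩ := ((move a b x).trans p).surjective y
  rw [mem_leftSet_iff_isLeft, Equiv.trans_apply, mem_leftSet_iff_isLeft]
  rcases x with i | j
  · rw [move_inl, swap_apply_def]
    grind
  · rw [move_inr_of_ne (by simpa using hx), swap_apply_def]
    grind

theorem leftSet_move_inr_self_trans (p : ι ⊕ ι ≃ β) :
    leftSet ((move a b (.inr b)).trans p) =
      insert (p (.inr b)) ((leftSet p).erase (p (.inl a))) := by
  ext y
  obtain ⟨z, rfl⟩ := ((move a b (.inr b)).trans p).surjective y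
  rw [mem_leftSet_iff_isLeft, Equiv.trans_apply, mem_insert, mem_erase, mem_leftSet_iff_isLeft,
    move_inr_self, swap_apply_def]
  simp only [ne_eq, EmbeddingLike.apply_eq_iff_eq]
  rcases z with i | j <;> grind

end Moves

section Transversal

variable {ι : Type*} [DecidableEq ι] {a b : ι}

@[simp] theorem transversalWord_inl (ε : ι → ℤˣ) (u v : Perm ι) (i : ι) :
    transversalWord ε u v (.inl i) = (u i, ε (u i)) := rfl

@[simp] theorem transversalWord_inr (ε : ι → ℤˣ) (u v : Perm ι) (j : ι) :
    transversalWord ε u v (.inr j) = (v j, -ε (v j)) := rfl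

theorem transversalWord_inj {ε ε' : ι → ℤˣ} {u u' v v' : Perm ι} :
    transversalWord ε u v = transversalWord ε' u' v' ↔ ε = ε' ∧ u = u' ∧ v = v' := by
  refine ⟨fun h => ?_, by rintro ⟨rfl, rfl, rfl⟩; rfl⟩
  have hl (i : ι) := DFunLike.congr_fun h (.inl i)
  have hr (j : ι) := DFunLike.congr_fun h (.inr j)
  simp only [transversalWord_inl, transversalWord_inr, Prod.mk.injEq] at hl hr
  have hu : u = u' := Equiv.ext fun i => (hl i).1
  refine ⟨funext fun k => ?_, hu, Equiv.ext fun j => (hr j).1⟩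
  obtain ⟨i, rfl⟩ := u.surjective k
  rw [(hl i).2, hu]

theorem move_inl_trans_transversalWord (ε : ι → ℤˣ) (u v : Perm ι) (i : ι) :
    (move a b (.inl i)).trans (transversalWord ε u v) =
      transversalWord ε (u * swap a i) v := by
  ext1 z
  rcases z with k | k
  · by_cases hk : k = a
    · simp [move_inl, hk]
    · by_cases hi : k = i
      · simp [move_inl, hi]
      · simp [move_inl, swap_apply_of_ne_of_ne, hk, hi]
  · simp [move_inl, swap_apply_of_ne_of_ne]

theorem move_inr_trans_transversalWord (ε : ι → ℤˣ) (u v : Perm ι) {j : ι} (hj : j ≠ b) :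
    (move a b (.inr j)).trans (transversalWord ε u v) =
      transversalWord ε u (v * swap b j) := by
  ext1 z
  rcases z with k | k
  · simp [move_inr_of_ne hj, swap_apply_of_ne_of_ne]
  · by_cases hk : k = b
    · simp [move_inr_of_ne hj, hk]
    · by_cases hi : k = j
      · simp [move_inr_of_ne hj, hi]
      · simp [move_inr_of_ne hj, swap_apply_of_ne_of_ne, hk, hi]

theorem move_inr_self_trans_transversalWord (ε : ι → ℤˣ) {u v : Perm ι} (h : v b = u a) :
    (move a b (.inr b)).trans (transversalWord ε u v) =
      transversalWord (ε * Pi.mulSingle (u a) (-1)) u v := by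
  ext1 z
  rcases z with k | k
  · by_cases hk : k = a
    · simp [move_inr_self, hk, h]
    · simp [move_inr_self, swap_apply_of_ne_of_ne, hk]
  · by_cases hk : k = b
    · simp [move_inr_self, hk, h]
    · have : v k ≠ u a := by rw [← h]; simpa using hk
      simp [move_inr_self, swap_apply_of_ne_of_ne, hk, this]

theorem exists_move_trans_eq_transversalWord (ε : ι → ℤˣ) {u v : Perm ι} (h : v b = u a)
    (x : ι ⊕ ι) :
    ∃ ε' u' v', (move a b x).trans (transversalWord ε u v) = transversalWord ε' u' v' := by
  rcases x with i | j
  · exact ⟨_, _, _, move_inl_trans_transversalWord ε u v i⟩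
  · by_cases hj : j = b
    · subst hj
      exact ⟨_, _, _, move_inr_self_trans_transversalWord ε h⟩
    · exact ⟨_, _, _, move_inr_trans_transversalWord ε u v hj⟩

variable [Fintype ι]

theorem isSeparated_transversalCode : IsSeparated a b (transversalCode a b) := by
  have flip (ε : ι → ℤˣ) (k : ι) :
      ∏ l, (ε * Pi.mulSingle k (-1) : ι → ℤˣ) l = -∏ l, ε l := by
    simp [prod_mul_distrib, Finset.prod_pi_mulSingle']
  have hneg (e : ℤˣ) : e ≠ -e := by
    rcases Int.units_eq_one_or e with h | h <;> rw [h] <;> decide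
  have hsign {u u' : Perm ι} {i : ι} (h : u * swap a i = u') (hs : Perm.sign u' = Perm.sign u) :
      u = u' := by
    by_cases hi : a = i
    · rwa [hi, swap_self, ← Perm.one_def, mul_one] at h
    · rw [← h, Perm.sign_mul, Perm.sign_swap hi] at hs
      exact absurd hs.symm (by simp)
  rintro _ ⟨ε, u, v, huv, hs, rfl⟩ _ ⟨ε', u', v', huv', hs', rfl⟩ x y h
  -- pairs of moves of different kinds never lead to a common word
  have hLR {ε ε' : ι → ℤˣ} {u v u' v' : Perm ι} {i j : ι} (huv : v b = u a) (huv' : v' b = u' a)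
      (hs : Perm.sign u = ∏ k, ε k) (hs' : Perm.sign u' = ∏ k, ε' k) (hj : j ≠ b)
      (h : (move a b (.inl i)).trans (transversalWord ε u v) =
        (move a b (.inr j)).trans (transversalWord ε' u' v')) : False := by
    rw [move_inl_trans_transversalWord, move_inr_trans_transversalWord _ _ _ hj,
      transversalWord_inj] at h
    obtain ⟨rfl, hu, hv⟩ := h
    obtain rfl := hsign hu (hs'.trans hs.symm)
    have := DFunLike.congr_fun hv b
    rw [huv, ← huv', Perm.mul_apply, swap_apply_left] at this
    exact hj (v'.injective this).symm
  have hLC {ε ε' : ι → ℤˣ} {u v u' v' : Perm ι} {i : ι} (huv : v b = u a) (huv' : v' b = u' a)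
      (hs : Perm.sign u = ∏ k, ε k) (hs' : Perm.sign u' = ∏ k, ε' k)
      (h : (move a b (.inl i)).trans (transversalWord ε u v) =
        (move a b (.inr b)).trans (transversalWord ε' u' v')) : False := by
    rw [move_inl_trans_transversalWord, move_inr_self_trans_transversalWord _ huv',
      transversalWord_inj] at h
    obtain ⟨rfl, hu, rfl⟩ := h
    rw [flip] at hs
    have hua := DFunLike.congr_fun hu i
    rw [Perm.mul_apply, swap_apply_right, ← huv, huv'] at hua
    obtain rfl := u'.injective hua
    simp only [swap_self, ← Perm.one_def, mul_one] at hu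
    rw [hu, hs'] at hs
    exact hneg _ hs
  have hRC {ε ε' : ι → ℤˣ} {u v u' v' : Perm ι} {j : ι} (huv' : v' b = u' a)
      (hs : Perm.sign u = ∏ k, ε k) (hs' : Perm.sign u' = ∏ k, ε' k) (hj : j ≠ b)
      (h : (move a b (.inr j)).trans (transversalWord ε u v) =
        (move a b (.inr b)).trans (transversalWord ε' u' v')) : False := by
    rw [move_inr_trans_transversalWord _ _ _ hj, move_inr_self_trans_transversalWord _ huv',
      transversalWord_inj] at h
    obtain ⟨rfl, rfl, -⟩ := h
    rw [flip, hs'] at hs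
    exact hneg _ hs
  rcases x with i | j <;> rcases y with i' | j'
  · have h' := h
    rw [move_inl_trans_transversalWord, move_inl_trans_transversalWord,
      transversalWord_inj] at h'
    obtain ⟨rfl, hu, rfl⟩ := h'
    exact transversalWord_inj.2 ⟨rfl, by
      have h1 := DFunLike.congr_fun hu i
      rw [Perm.mul_apply, swap_apply_right, ← huv, huv', Perm.mul_apply] at h1
      have h2 := (swap a i').injective ((u'.injective h1).symm.trans (swap_apply_right _ _).symm)
      rw [h2] at hu
      exact mul_right_cancel hu, rfl⟩
  · by_cases hj : j' = b
    · subst hj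
      exact (hLC huv huv' hs hs' h).elim
    · exact (hLR huv huv' hs hs' hj h).elim
  · by_cases hj : j = b
    · subst hj
      exact (hLC huv' huv hs' hs h.symm).elim
    · exact (hLR huv' huv hs' hs hj h.symm).elim
  · by_cases hj : j = b <;> by_cases hj' : j' = b
    · rw [hj, hj'] at h
      exact trans_left_cancel h
    · rw [hj] at h
      exact (hRC huv hs' hs hj' h.symm).elim
    · rw [hj'] at h
      exact (hRC huv' hs hs' hj h).elim
    · have h' := h
      rw [move_inr_trans_transversalWord _ _ _ hj, move_inr_trans_transversalWord _ _ _ hj',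
        transversalWord_inj] at h'
      obtain ⟨rfl, rfl, hv⟩ := h'
      exact transversalWord_inj.2 ⟨rfl, rfl, by
        have h1 := DFunLike.congr_fun hv j
        rw [Perm.mul_apply, swap_apply_right, huv, ← huv', Perm.mul_apply] at h1
        have h2 := (swap b j').injective ((v'.injective h1).symm.trans (swap_apply_right _ _).symm)
        rw [h2] at hv
        exact mul_right_cancel hv⟩

theorem not_isMixed_leftSet_transversalWord (ε : ι → ℤˣ) (u v : Perm ι) :
    ¬ IsMixed (leftSet (transversalWord ε u v)) := by
  rintro ⟨-, ⟨k, h1, h2⟩, -⟩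
  obtain ⟨i, hi⟩ := mem_leftSet.1 h1
  obtain ⟨j, hj⟩ := mem_leftSet.1 h2
  simp only [transversalWord_inl, Prod.mk.injEq] at hi hj
  have := hi.2.symm.trans (by rw [hi.1, ← hj.1, hj.2])
  exact absurd this (by decide)

end Transversal

section Mixed

theorem CenterRule.mem {ι : Type*} {A : Finset (ι × ℤˣ)} {x y : ι × ℤˣ}
    (h : CenterRule A x y) : x ∈ A := by
  rcases h with ⟨f, s, h1, -, -, -, rfl, -⟩ | ⟨-, s, e, h1, -, -, -, rfl, -⟩ <;> exact h1

theorem CenterRule.notMem {ι : Type*} {A : Finset (ι × ℤˣ)} {x y : ι × ℤˣ}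
    (h : CenterRule A x y) : y ∉ A := by
  rcases h with ⟨f, s, -, -, -, h1, -, rfl⟩ | ⟨-, s, e, -, -, h1, -, -, rfl⟩ <;> exact h1

/-- The centers allowed before and after exchanging `x` for `y` do not interfere. -/
theorem CenterRule.ne_of_exchange {ι : Type*} [DecidableEq ι] {A : Finset (ι × ℤˣ)}
    {x y x' y' : ι × ℤˣ} (h : CenterRule A x y) (h' : CenterRule (insert y (A.erase x)) x' y') :
    x' ≠ y ∧ y' ≠ x := by
  have hne : (1 : ℤˣ) ≠ -1 := by decide
  rcases h with ⟨f, s, h1, h2, h3, h4, rfl, rfl⟩ | ⟨h0, s, e, h1, h2, h3, h4, rfl, rfl⟩ <;>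
  rcases h' with ⟨f', s', g1, g2, g3, g4, rfl, rfl⟩ | ⟨g0, s', e', g1, g2, g3, g4, rfl, rfl⟩ <;>
  simp only [mem_insert, mem_erase, Prod.mk.injEq, ne_eq] at * <;> grind

variable {ι : Type*} [Fintype ι] [DecidableEq ι] {a b : ι} {A : Finset (ι × ℤˣ)}

theorem IsMixed.exists_notMem (hA : IsMixed A) : ∃ e, (e, 1) ∉ A ∧ (e, -1) ∉ A := by
  obtain ⟨hc, ⟨f, hf, hf'⟩, -⟩ := hA
  by_contra! h
  have : (A.erase (f, 1)).image Prod.fst = univ := by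
    refine eq_univ_of_forall fun k => ?_
    by_cases hk : (k, 1) ∈ A ∧ k ≠ f
    · exact mem_image.2 ⟨(k, 1), by simp [hk], rfl⟩
    · refine mem_image.2 ⟨(k, -1), ?_, rfl⟩
      rw [mem_erase]
      refine ⟨by simp, ?_⟩
      by_cases hkf : k = f
      · rwa [hkf]
      · exact h k fun h1 => hk ⟨h1, hkf⟩
  have h1 := card_image_le (s := A.erase (f, 1)) (f := Prod.fst)
  rw [this, card_erase_of_mem hf, hc, card_univ] at h1
  have : 0 < Fintype.card ι := Fintype.card_pos_iff.2 ⟨f⟩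
  omega

theorem IsMixed.exists_centerRule (hA : IsMixed A) : ∃ x y, CenterRule A x y := by
  obtain ⟨e, he, he'⟩ := hA.exists_notMem
  obtain ⟨-, ⟨f, hf, hf'⟩, s, hs⟩ := hA
  by_cases h : ∀ s, (s, 1) ∈ A → (s, -1) ∈ A
  · have hs' : (s, 1) ∉ A ∧ (s, -1) ∈ A := hs.resolve_left fun h' => h'.2 (h s h'.1)
    exact ⟨_, _, .inr ⟨h, s, e, hs'.2, hs'.1, he, he', rfl, rfl⟩⟩
  · push Not at h
    obtain ⟨t, ht, ht'⟩ := h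
    exact ⟨_, _, .inl ⟨f, t, hf, hf', ht, ht', rfl, rfl⟩⟩

theorem CenterRule.isMixed_exchange {x y : ι × ℤˣ} (h : CenterRule A x y) (hA : IsMixed A) :
    IsMixed (insert y (A.erase x)) := by
  refine ⟨?_, ?_, ?_⟩
  · rw [card_insert_of_notMem (fun h' => h.notMem (mem_of_mem_erase h')), card_erase_of_mem h.mem,
      hA.1, Nat.sub_add_cancel]
    rw [← hA.1]
    exact card_pos.2 ⟨x, h.mem⟩
  · rcases h with ⟨f, s, h1, h2, h3, h4, rfl, rfl⟩ | ⟨h0, s, e, h1, h2, h3, h4, rfl, rfl⟩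
    · have : s ≠ f := by rintro rfl; exact h4 h2
      exact ⟨s, by simp [this, h3], by simp⟩
    · obtain ⟨f, hf, hf'⟩ := hA.2.1
      have : f ≠ s := by rintro rfl; exact h2 hf
      exact ⟨f, by simp [hf], by simp [this, hf']⟩
  · rcases h with ⟨f, s, h1, h2, h3, h4, rfl, rfl⟩ | ⟨h0, s, e, h1, h2, h3, h4, rfl, rfl⟩
    · have : f ≠ s := by rintro rfl; exact h4 h2
      exact ⟨f, .inr ⟨by simp, by simp [h2]⟩⟩
    · exact ⟨e, .inl ⟨by simp, by simp [h4]⟩⟩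

theorem isSeparated_mixedCode {c : Finset (ι × ℤˣ) → (ι × ℤˣ) × (ι × ℤˣ)}
    (hc : ∀ A, IsMixed A → CenterRule A (c A).1 (c A).2) : IsSeparated a b (mixedCode a b c) := by
  have hC {p q : ι ⊕ ι ≃ ι × ℤˣ} (hp : p ∈ mixedCode a b c) (hq : q ∈ mixedCode a b c)
      {y : ι ⊕ ι} (hy : y ≠ .inr b)
      (h : (move a b (.inr b)).trans p = (move a b y).trans q) : False := by
    obtain ⟨hpm, hpa, hpb⟩ := hp
    obtain ⟨hqm, hqa, hqb⟩ := hq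
    have hA := congrArg leftSet h
    rw [leftSet_move_trans q hy, leftSet_move_inr_self_trans, hpa, hpb] at hA
    have hne := (hc _ hpm).ne_of_exchange (x' := (c (leftSet q)).1) (y' := (c (leftSet q)).2)
      (by rw [hA]; exact hc _ hqm)
    rcases y with i | j
    · have := DFunLike.congr_fun h (.inr b)
      simp only [Equiv.trans_apply, move_inr_self, swap_apply_right, move_inl] at this
      rw [swap_apply_of_ne_of_ne (by simp) (by simp), hpa, hqb] at this
      exact hne.2 this.symm
    · have := DFunLike.congr_fun h (.inl a)
      simp only [Equiv.trans_apply, move_inr_self, swap_apply_left] at this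
      rw [move_inr_of_ne (by rintro rfl; exact hy rfl)] at this
      rw [swap_apply_of_ne_of_ne (by simp) (by simp), hpb, hqa] at this
      exact hne.1 this.symm
  intro p hp q hq x y h
  by_cases hx : x = .inr b <;> by_cases hy : y = .inr b
  · subst hx hy
    exact trans_left_cancel h
  · subst hx
    exact (hC hp hq hy h).elim
  · subst hy
    exact (hC hq hp hx h.symm).elim
  · have hA := congrArg leftSet h
    rw [leftSet_move_trans p hx, leftSet_move_trans q hy] at hA
    have center {z : ι ⊕ ι} (hz : p z = q z) : move a b x z = move a b y z := by
      apply ((move a b x).trans p).injective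
      have h1 : ((move a b x).trans p) (move a b x z) = p z := by
        rw [Equiv.trans_apply]; nth_rewrite 1 [← move_symm]; rw [symm_apply_apply]
      have h2 : ((move a b y).trans q) (move a b y z) = q z := by
        rw [Equiv.trans_apply]; nth_rewrite 1 [← move_symm]; rw [symm_apply_apply]
      rw [h1, h, h2, hz]
    obtain ⟨-, hpa, hpb⟩ := hp
    obtain ⟨-, hqa, hqb⟩ := hq
    have hxy := move_ext (center (hpa.trans (by rw [hA, hqa])))
      (center (hpb.trans (by rw [hA, hqb])))
    subst hxy
    exact trans_left_cancel h

theorem isMixed_leftSet_move_trans {c : Finset (ι × ℤˣ) → (ι × ℤˣ) × (ι × ℤˣ)}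
    (hc : ∀ A, IsMixed A → CenterRule A (c A).1 (c A).2) {p : ι ⊕ ι ≃ ι × ℤˣ}
    (hp : p ∈ mixedCode a b c) (x : ι ⊕ ι) : IsMixed (leftSet ((move a b x).trans p)) := by
  obtain ⟨hpm, hpa, hpb⟩ := hp
  by_cases hx : x = .inr b
  · rw [hx, leftSet_move_inr_self_trans, hpa, hpb]
    exact (hc _ hpm).isMixed_exchange hpm
  · rwa [leftSet_move_trans p hx]

theorem isSeparated_union {c : Finset (ι × ℤˣ) → (ι × ℤˣ) × (ι × ℤˣ)}
    (hc : ∀ A, IsMixed A → CenterRule A (c A).1 (c A).2) :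
    IsSeparated a b (transversalCode a b ∪ mixedCode a b c) := by
  have hne {p q : ι ⊕ ι ≃ ι × ℤˣ} (hp : p ∈ transversalCode a b) (hq : q ∈ mixedCode a b c)
      {x y : ι ⊕ ι} (h : (move a b x).trans p = (move a b y).trans q) : False := by
    obtain ⟨ε, u, v, huv, -, rfl⟩ := hp
    obtain ⟨ε', u', v', h'⟩ := exists_move_trans_eq_transversalWord ε huv x
    have := isMixed_leftSet_move_trans hc hq y
    rw [← h, h'] at this
    exact not_isMixed_leftSet_transversalWord _ _ _ this
  rintro p (hp | hp) q (hq | hq) x y h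
  · exact isSeparated_transversalCode p hp q hq x y h
  · exact (hne hp hq h).elim
  · exact (hne hq hp h.symm).elim
  · exact isSeparated_mixedCode hc p hp q hq x y h

end Mixed

end DoubleStar

namespace DoubleStar

open Equiv Finset
open scoped Nat

variable {ι : Type*} [Fintype ι] [DecidableEq ι]

theorem card_perm_ne (a : ι) : Nat.card (Perm {x // x ≠ a}) = (Fintype.card ι - 1)! := by
  rw [Nat.card_eq_fintype_card, Fintype.card_perm, Fintype.card_subtype_compl,
    Fintype.card_subtype_eq]

theorem le_two_mul_ncard_transversalCode (a b : ι) :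
    2 ^ Fintype.card ι * ((Fintype.card ι)! * (Fintype.card ι - 1)!) ≤
      2 * (transversalCode a b).ncard := by
  classical
  let I := (ι → ℤˣ) × Perm ι × Perm {x // x ≠ b}
  let P : I → Prop := fun t => Perm.sign t.2.1 = ∏ k, t.1 k
  let f : I → (ι ⊕ ι ≃ ι × ℤˣ) := fun t =>
    transversalWord t.1 t.2.1 (swap b (t.2.1 a) * Perm.ofSubtype t.2.2)
  have hf : Function.Injective f := by
    rintro ⟨ε, u, w⟩ ⟨ε', u', w'⟩ h
    obtain ⟨rfl, rfl, h⟩ := transversalWord_inj.1 h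
    have hw : w = w' := Perm.ofSubtype_injective (mul_left_cancel h)
    rw [hw]
  have hle : #{t | P t} ≤ (transversalCode a b).ncard := by
    rw [← Set.ncard_coe_finset, ← Set.ncard_image_of_injective _ hf]
    refine Set.ncard_le_ncard ?_ (Set.toFinite _)
    rintro _ ⟨⟨ε, u, w⟩, ht, rfl⟩
    refine ⟨ε, u, _, ?_, by simpa [P] using ht, rfl⟩
    rw [Perm.mul_apply, Perm.ofSubtype_apply_of_not_mem _ (by simp), swap_apply_left]
  let g : I → I := fun t => (t.1 * Pi.mulSingle a (-1), t.2)
  have hg : Function.Injective g := fun t t' h =>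
    Prod.ext (mul_right_cancel (congrArg (·.1) h)) (congrArg (·.2) h :)
  have hgP (t : I) (ht : ¬ P t) : P (g t) := by
    have : ∏ k, (g t).1 k = -∏ k, t.1 k := by
      simp [g, prod_mul_distrib, Finset.prod_pi_mulSingle']
    change Perm.sign t.2.1 = ∏ k, (g t).1 k
    rw [this]
    rcases Int.units_eq_one_or (Perm.sign t.2.1) with h | h <;>
      rcases Int.units_eq_one_or (∏ k, t.1 k) with h' | h' <;> simp_all [P]
  have hcompl : #{t | ¬ P t} ≤ #{t | P t} :=
    card_le_card_of_injOn g (fun t ht => by simpa using hgP t (by simpa using ht)) hg.injOn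
  have hsum : #{t | P t} + #{t | ¬ P t} = #(univ : Finset I) := card_filter_add_card_filter_not P
  have hI : #(univ : Finset I) =
      2 ^ Fintype.card ι * ((Fintype.card ι)! * (Fintype.card ι - 1)!) := by
    have := card_perm_ne b
    rw [Nat.card_eq_fintype_card] at this
    rw [card_univ, Fintype.card_prod, Fintype.card_prod, this, Fintype.card_perm, Fintype.card_fun,
      Fintype.card_units_int]
  omega

theorem exists_word {β : Type*} [Fintype β] [DecidableEq β]
    (hβ : Fintype.card β = 2 * Fintype.card ι) (a b : ι) {A : Finset β}
    (hA : #A = Fintype.card ι) {x y : β} (hx : x ∈ A) (hy : y ∉ A) :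
    ∃ p : ι ⊕ ι ≃ β, leftSet p = A ∧ p (.inl a) = x ∧ p (.inr b) = y := by
  have e₁ : ι ≃ {z // z ∈ A} := Fintype.equivOfCardEq (by simp [hA])
  have e₂ : ι ≃ {z // z ∉ A} := Fintype.equivOfCardEq (by
    rw [Fintype.card_subtype_compl, Fintype.card_coe]; omega)
  let l := (swap a (e₁.symm ⟨x, hx⟩)).trans e₁
  let m := (swap b (e₂.symm ⟨y, hy⟩)).trans e₂
  refine ⟨(Equiv.sumCongr l m).trans (Equiv.sumCompl (· ∈ A)), ?_, by simp [l], by simp [m]⟩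
  ext z
  rw [mem_leftSet]
  refine ⟨?_, fun hz => ⟨l.symm ⟨z, hz⟩, by simp⟩⟩
  rintro ⟨i, rfl⟩
  simp

theorem leftSet_sumCongr_trans {ι β : Type*} [Fintype ι] [DecidableEq β] (u v : Perm ι)
    (p : ι ⊕ ι ≃ β) :
    leftSet ((Equiv.sumCongr u v).trans p) = leftSet p := by
  ext y
  simp only [mem_leftSet, Equiv.trans_apply, sumCongr_apply, Sum.map_inl]
  exact u.exists_congr_left.trans (by simp)

open Classical in
theorem le_ncard_mixedCode (a b : ι) {c : Finset (ι × ℤˣ) → (ι × ℤˣ) × (ι × ℤˣ)}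
    (hc : ∀ A, IsMixed A → CenterRule A (c A).1 (c A).2) :
    #{A : Finset (ι × ℤˣ) | IsMixed A} * ((Fintype.card ι - 1)! * (Fintype.card ι - 1)!) ≤
      (mixedCode a b c).ncard := by
  have hw (A : {A : Finset (ι × ℤˣ) // IsMixed A}) : ∃ p : ι ⊕ ι ≃ ι × ℤˣ,
      leftSet p = A.1 ∧ p (.inl a) = (c A).1 ∧ p (.inr b) = (c A).2 :=
    exists_word (by simp [mul_comm]) a b A.2.1 (hc _ A.2).mem (hc _ A.2).notMem
  choose w hwA hwa hwb using hw
  let f : {A : Finset (ι × ℤˣ) // IsMixed A} × Perm {x // x ≠ a} × Perm {x // x ≠ b} →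
      (ι ⊕ ι ≃ ι × ℤˣ) := fun t =>
    (Equiv.sumCongr (Perm.ofSubtype t.2.1) (Perm.ofSubtype t.2.2)).trans (w t.1)
  have hfA (t) : leftSet (f t) = t.1.1 := by rw [leftSet_sumCongr_trans, hwA]
  have hf : Function.Injective f := by
    rintro ⟨A, u, v⟩ ⟨A', u', v'⟩ h
    have hA : A = A' := Subtype.ext (by simpa only [hfA] using congrArg leftSet h)
    subst hA
    have h' (z) := (w A).injective (DFunLike.congr_fun h z)
    have hu : u = u' := Perm.ofSubtype_injective (Equiv.ext fun i => by simpa using h' (.inl i))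
    have hv : v = v' := Perm.ofSubtype_injective (Equiv.ext fun i => by simpa using h' (.inr i))
    rw [hu, hv]
  calc _ = Nat.card ({A : Finset (ι × ℤˣ) // IsMixed A} × Perm {x // x ≠ a} ×
        Perm {x // x ≠ b}) := by
        rw [Nat.card_prod, Nat.card_prod, card_perm_ne, card_perm_ne, Nat.card_eq_fintype_card,
          Fintype.card_subtype]
    _ = (Set.range f).ncard := (Set.ncard_range_of_injective hf).symm
    _ ≤ _ := by
      refine Set.ncard_le_ncard ?_ (Set.toFinite _)
      rintro _ ⟨t, rfl⟩
      refine ⟨by rw [hfA]; exact t.1.2, ?_, ?_⟩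
      · simp only [hfA, ← hwa]
        simp [f, Perm.ofSubtype_apply_of_not_mem]
      · simp only [hfA, ← hwb]
        simp [f, Perm.ofSubtype_apply_of_not_mem]

open Classical in
theorem choose_le_card_isMixed :
    (2 * Fintype.card ι).choose (Fintype.card ι) ≤
      #{A : Finset (ι × ℤˣ) | IsMixed A} + 2 ^ Fintype.card ι +
        if Fintype.card ι % 2 = 1 then 0 else
          (Fintype.card ι).choose (Fintype.card ι / 2) := by
  let T : Finset (Finset (ι × ℤˣ)) := univ.image fun ε : ι → ℤˣ => univ.image fun k => (k, ε k)
  let Q : Finset (Finset (ι × ℤˣ)) := if Fintype.card ι % 2 = 1 then ∅ else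
    (powersetCard (Fintype.card ι / 2) univ).image fun S => S ×ˢ univ
  have hT : #T ≤ 2 ^ Fintype.card ι := card_image_le.trans (by simp)
  have hQ : #Q ≤ if Fintype.card ι % 2 = 1 then 0 else
      (Fintype.card ι).choose (Fintype.card ι / 2) := by
    unfold Q
    split_ifs
    · simp
    · exact card_image_le.trans (by simp)
  have hsub : powersetCard (Fintype.card ι) (univ : Finset (ι × ℤˣ)) ⊆
      ({A : Finset (ι × ℤˣ) | IsMixed A} : Finset _) ∪ T ∪ Q := by
    intro A hA
    have hA : #A = Fintype.card ι := by simpa using hA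
    by_contra hAn
    simp only [mem_union, not_or] at hAn
    obtain ⟨⟨hM, hT⟩, hQ⟩ := hAn
    have hM : ¬ IsMixed A := by simpa using hM
    by_cases hF : ∃ k, (k, 1) ∈ A ∧ (k, -1) ∈ A
    · have hS : ∀ k, (k, (1 : ℤˣ)) ∈ A ↔ (k, -1) ∈ A := by
        by_contra! h
        obtain ⟨k, hk⟩ := h
        exact hM ⟨hA, hF, k, hk⟩
      have hAS : A = A.image Prod.fst ×ˢ univ := by
        ext ⟨k, e⟩
        simp only [mem_product, mem_image, mem_univ, and_true]
        refine ⟨fun h => ⟨_, h, rfl⟩, ?_⟩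
        rintro ⟨⟨k', e'⟩, h, rfl⟩
        rcases Int.units_eq_one_or e with rfl | rfl <;>
          rcases Int.units_eq_one_or e' with rfl | rfl <;> simp_all
      have hcard : #A = #(A.image Prod.fst) * 2 := by
        conv_lhs => rw [hAS, card_product]
        simp
      apply hQ
      unfold Q
      rw [if_neg (by omega)]
      exact mem_image.2 ⟨_, by simp only [mem_powersetCard_univ]; omega, hAS.symm⟩
    · push Not at hF
      have hinj : Set.InjOn Prod.fst (A : Set (ι × ℤˣ)) := by
        rintro ⟨k, e⟩ h ⟨k', e'⟩ h' (rfl : k = k')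
        rcases Int.units_eq_one_or e with rfl | rfl <;>
          rcases Int.units_eq_one_or e' with rfl | rfl <;> simp_all
      have himg : A.image Prod.fst = univ := by
        rw [← card_eq_iff_eq_univ, card_image_of_injOn hinj, hA]
      have hex (k : ι) : ∃ e, (k, e) ∈ A := by
        have := himg ▸ mem_univ k
        simpa using this
      choose ε hε using hex
      refine hT (mem_image.2 ⟨ε, mem_univ _, eq_of_subset_of_card_le ?_ ?_⟩)
      · intro z hz
        obtain ⟨k, -, rfl⟩ := mem_image.1 hz
        exact hε k
      · rw [card_image_of_injective _ fun k k' h => congrArg Prod.fst h, hA, card_univ]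
  have h := card_le_card hsub
  rw [card_powersetCard, card_univ, Fintype.card_prod, Fintype.card_units_int, mul_comm] at h
  have := card_union_le (({A : Finset (ι × ℤˣ) | IsMixed A} : Finset _) ∪ T) Q
  have := card_union_le ({A : Finset (ι × ℤˣ) | IsMixed A} : Finset _) T
  omega

open Classical in
theorem Pnum_le_card_isMixed :
    Pnum (Fintype.card ι) ≤ #{A : Finset (ι × ℤˣ) | IsMixed A} := by
  have h := choose_le_card_isMixed (ι := ι)
  unfold Pnum
  split_ifs at h ⊢ <;> omega

/-- A large separated set of words. -/
theorem exists_isSeparated (a b : ι) : ∃ C : Set (ι ⊕ ι ≃ ι × ℤˣ), IsSeparated a b C ∧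
    2 ^ Fintype.card ι * ((Fintype.card ι)! * (Fintype.card ι - 1)!) +
      2 * (Pnum (Fintype.card ι) * ((Fintype.card ι - 1)! * (Fintype.card ι - 1)!)) ≤
        2 * C.ncard := by
  classical
  have hex (A : Finset (ι × ℤˣ)) :
      ∃ c : (ι × ℤˣ) × (ι × ℤˣ), IsMixed A → CenterRule A c.1 c.2 := by
    by_cases hA : IsMixed A
    · obtain ⟨x, y, h⟩ := hA.exists_centerRule
      exact ⟨(x, y), fun _ => h⟩
    · exact ⟨((a, 1), (a, 1)), fun h => absurd h hA⟩
  choose c hc using hex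
  refine ⟨_, isSeparated_union hc, ?_⟩
  have hdisj : Disjoint (transversalCode a b) (mixedCode a b c) := by
    rw [Set.disjoint_left]
    rintro _ ⟨ε, u, v, -, -, rfl⟩ h
    exact not_isMixed_leftSet_transversalWord _ _ _ h.1
  rw [Set.ncard_union_eq hdisj (Set.toFinite _) (Set.toFinite _), mul_add]
  have h := (Nat.mul_le_mul_right _ Pnum_le_card_isMixed).trans (le_ncard_mixedCode a b hc)
  exact add_le_add (le_two_mul_ncard_transversalCode a b) (Nat.mul_le_mul_left 2 h)

end DoubleStar

namespace DoubleStar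

open Equiv Finset

theorem permCongr_swap {α β : Type*} [DecidableEq α] [DecidableEq β] (e : α ≃ β) (x y : α) :
    e.permCongr (swap x y) = swap (e x) (e y) := by
  rw [permCongr_def, symm_trans_swap_trans]

theorem mem_closedNbr_cayley {n : ℕ} {τ : SimpleGraph (Fin n)} {g h : Perm (Fin n)} :
    h ∈ closedNbr (cayley τ) g ↔ h = g ∨ ∃ i j, τ.Adj i j ∧ h = swap i j * g := by
  have hinv (i j : Fin n) : g = swap i j * h ↔ h = swap i j * g := by
    constructor <;> intro h' <;> rw [h', swap_mul_self_mul]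
  have hne {i j : Fin n} (hij : τ.Adj i j) : g ≠ swap i j * g := by
    simp [hij.ne]
  simp only [closedNbr, Set.mem_insert_iff, SimpleGraph.mem_neighborSet, cayley,
    SimpleGraph.fromRel_adj, mul_inv_eq_iff_eq_mul, hinv, or_self]
  refine or_congr_right ⟨fun h => h.2, ?_⟩
  rintro ⟨i, j, hij, rfl⟩
  exact ⟨hne hij, i, j, hij, rfl⟩

theorem mem_closedNbr_X3 {r : ℕ} (hr : 0 < r) {g h : Perm (Fin (r + r))} :
    h ∈ closedNbr (X3 r r) g ↔ ∃ x, h =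
      finSumFinEquiv.permCongr (move (⟨r - 1, by omega⟩ : Fin r) ⟨0, hr⟩ x) * g := by
  rw [X3, mem_closedNbr_cayley]
  set a : Fin r := ⟨r - 1, by omega⟩ with ha
  set b : Fin r := ⟨0, hr⟩ with hb
  have hl (i : Fin r) : (doubleStar r r).Adj (finSumFinEquiv (.inl a)) (finSumFinEquiv (.inl i)) ↔
      i ≠ a := by
    simp [doubleStar, Fin.ext_iff, ha]
    omega
  have hr' (j : Fin r) : (doubleStar r r).Adj (finSumFinEquiv (.inr b)) (finSumFinEquiv (.inr j)) ↔
      j ≠ b := by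
    simp [doubleStar, Fin.ext_iff, hb]
    omega
  have hc : (doubleStar r r).Adj (finSumFinEquiv (.inl a)) (finSumFinEquiv (.inr b)) := by
    simp [doubleStar, Fin.ext_iff, ha, hb]
    omega
  constructor
  · rintro (rfl | ⟨i, j, hij, rfl⟩)
    · exact ⟨.inl a, by rw [move_inl, permCongr_swap, swap_self]; rfl⟩
    · suffices hs : ∃ x, swap i j = finSumFinEquiv.permCongr (move a b x) by
        obtain ⟨x, hx⟩ := hs
        exact ⟨x, by rw [hx]⟩
      have key {i j : Fin (r + r)} (h : ((i : ℕ) < r - 1 ∧ (j : ℕ) = r - 1) ∨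
          ((i : ℕ) = r - 1 ∧ (j : ℕ) = r) ∨ ((i : ℕ) = r ∧ r < (j : ℕ))) :
          ∃ x, swap i j = finSumFinEquiv.permCongr (move a b x) := by
        rcases h with ⟨h₁, h₂⟩ | ⟨h₁, h₂⟩ | ⟨h₁, h₂⟩
        · refine ⟨.inl ⟨i, by omega⟩, ?_⟩
          rw [move_inl, permCongr_swap, swap_comm]
          congr 1
          ext
          simpa [ha] using h₂
        · refine ⟨.inr b, ?_⟩
          rw [move_inr_self, permCongr_swap]
          congr 1 <;> ext <;> simpa [ha, hb]
        · refine ⟨.inr ⟨j - r, by omega⟩, ?_⟩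
          rw [move_inr_of_ne (by simp [hb]; omega), permCongr_swap]
          congr 1 <;> ext
          · simpa [hb] using h₁
          · simp
            omega
      rcases hij.2 with h | h
      · exact key h
      · rw [swap_comm]
        exact key h
  · rintro ⟨i | j, rfl⟩
    · by_cases hi : i = a
      · left
        rw [hi, move_inl, permCongr_swap, swap_self]
        rfl
      · exact .inr ⟨_, _, (hl i).2 hi, by rw [move_inl, permCongr_swap]⟩
    · by_cases hj : j = b
      · exact .inr ⟨_, _, hc, by rw [hj, move_inr_self, permCongr_swap]⟩
      · exact .inr ⟨_, _, (hr' j).2 hj, by rw [move_inr_of_ne hj, permCongr_swap]⟩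

/-- A separated set of words on `r` left and `r` right positions yields a packing in `X3 r r`. -/
theorem exists_packing_of_isSeparated {r : ℕ} (hr : 0 < r) {C : Set (Fin r ⊕ Fin r ≃ Fin r × ℤˣ)}
    (hC : IsSeparated ⟨r - 1, by omega⟩ ⟨0, hr⟩ C) :
    ∃ J : Set (Perm (Fin (r + r))), IsSpherePacking (X3 r r) J ∧
      (⋃ v ∈ J, closedNbr (X3 r r) v).ncard = 2 * r * C.ncard := by
  let c : Fin r × ℤˣ ≃ Fin (r + r) := Fintype.equivOfCardEq (by simp; ring)
  let Φ : (Fin r ⊕ Fin r ≃ Fin r × ℤˣ) → Perm (Fin (r + r)) := fun p =>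
    c.symm.trans (p.symm.trans finSumFinEquiv)
  have hΦ : Function.Injective Φ := fun p q h => by
    have := trans_left_cancel h
    ext1 z
    have hz : p.symm (q z) = z :=
      finSumFinEquiv.injective (by simpa using DFunLike.congr_fun this (q z))
    rw [← hz, apply_symm_apply, hz]
  have hmove (p) (x) : finSumFinEquiv.permCongr (move ⟨r - 1, by omega⟩ ⟨0, hr⟩ x) * Φ p =
      Φ ((move ⟨r - 1, by omega⟩ ⟨0, hr⟩ x).trans p) := by
    ext1 k
    simp [Φ, move_symm]
  have hmem (p) (h : Perm (Fin (r + r))) : h ∈ closedNbr (X3 r r) (Φ p) ↔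
      ∃ x, h = Φ ((move ⟨r - 1, by omega⟩ ⟨0, hr⟩ x).trans p) := by
    simp only [mem_closedNbr_X3 hr, hmove]
  refine ⟨Φ '' C, ?_, ?_⟩
  · rintro _ ⟨p, hp, rfl⟩ _ ⟨q, hq, rfl⟩ hne
    refine Set.disjoint_left.2 fun h h₁ h₂ => hne ?_
    obtain ⟨x, rfl⟩ := (hmem _ _).1 h₁
    obtain ⟨y, hy⟩ := (hmem _ _).1 h₂
    rw [hC p hp q hq x y (hΦ hy)]
  · let f : (Fin r ⊕ Fin r) × (Fin r ⊕ Fin r ≃ Fin r × ℤˣ) → Perm (Fin (r + r)) := fun t =>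
      Φ ((move ⟨r - 1, by omega⟩ ⟨0, hr⟩ t.1).trans t.2)
    have hU : (⋃ v ∈ Φ '' C, closedNbr (X3 r r) v) = f '' (Set.univ ×ˢ C) := by
      ext h
      simp only [Set.mem_iUnion, Set.exists_mem_image, exists_prop, hmem]
      constructor
      · rintro ⟨p, hp, x, rfl⟩
        exact ⟨(x, p), ⟨trivial, hp⟩, rfl⟩
      · rintro ⟨⟨x, p⟩, ⟨-, hp⟩, rfl⟩
        exact ⟨p, hp, x, rfl⟩
    have hf : Set.InjOn f (Set.univ ×ˢ C) := by
      rintro ⟨x, p⟩ ⟨-, hp⟩ ⟨y, q⟩ ⟨-, hq⟩ h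
      have h := hΦ h
      obtain rfl : p = q := hC p hp q hq x y h
      have hxy : x = y := move_injective <| Equiv.ext fun z =>
        p.injective (DFunLike.congr_fun h z)
      rw [hxy]
    rw [hU, hf.ncard_image, Set.ncard_prod, Set.ncard_univ, Nat.card_eq_fintype_card,
      Fintype.card_sum, Fintype.card_fin, two_mul]

end DoubleStar

/-- for `r ≥ 3` there is a 1-sphere packing of `X³_{r,r}` whose closed
neighborhoods cover exactly `2^r (r!)² + 2 P_r (r-1)! r!` vertices. -/
theorem nonuniform_packing_exists (r : ℕ) (hr : 3 ≤ r) :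
    ∃ J : Set (Equiv.Perm (Fin (r + r))), IsSpherePacking (X3 r r) J ∧
      (⋃ v ∈ J, closedNbr (X3 r r) v).ncard =
        2 ^ r * r.factorial ^ 2 + 2 * Pnum r * (r - 1).factorial * r.factorial := by
  obtain ⟨C, hC, hle⟩ := DoubleStar.exists_isSeparated (⟨r - 1, by omega⟩ : Fin r) ⟨0, by omega⟩
  rw [Fintype.card_fin] at hle
  obtain ⟨k, rfl⟩ : ∃ k, r = k + 1 := ⟨r - 1, by omega⟩
  rw [Nat.add_sub_cancel] at hle ⊢
  set N := 2 ^ k * ((k + 1).factorial * k.factorial) +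
    Pnum (k + 1) * (k.factorial * k.factorial) with hN
  have hNC : N ≤ C.ncard := by
    rw [pow_succ] at hle
    linarith
  obtain ⟨D, hDC, hD⟩ := Set.exists_subset_card_eq hNC
  obtain ⟨J, hJ, hcard⟩ := DoubleStar.exists_packing_of_isSeparated (by omega)
    (fun p hp q hq => hC p (hDC hp) q (hDC hq))
  refine ⟨J, hJ, ?_⟩
  rw [hcard, hD, hN, Nat.factorial_succ]
  ring
end

section
/- For every integer r ≥ 3, the following arithmetic inequalities hold: 2·(2r)! < r·(2^r (r!)² + 2 P_r (r−1)! r!) and 2^r (r!)² + 2 P_r (r−1)! r! < (2r)!. Equivalently, with α = (2^r + (2/r)P_r)/binomial(2r,r), one has 2r/r² < α < 1. -/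
theorem two_pow_lt_centralBinom {r : ℕ} (hr : 2 ≤ r) : 2 ^ r < r.centralBinom := by
  induction r, hr using Nat.le_induction with
  | base => decide
  | succ n _ ih =>
    have h := Nat.succ_mul_centralBinom_succ n
    rw [pow_succ]
    nlinarith

theorem choose_le_Pnum_add (r : ℕ) :
    (2 * r).choose r ≤ Pnum r + 2 ^ r + r.choose (r / 2) := by
  unfold Pnum
  split_ifs <;> omega

theorem choose_le_Pnum_add_of_odd {r : ℕ} (hr : r % 2 = 1) :
    (2 * r).choose r ≤ Pnum r + 2 ^ r := by
  unfold Pnum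
  rw [if_pos hr]
  omega

theorem Pnum_le (r : ℕ) : Pnum r ≤ (2 * r).choose r - 2 ^ r := by
  unfold Pnum
  split_ifs <;> omega

theorem alpha_lower_choose {r : ℕ} (hr : 3 ≤ r) :
    2 * (2 * r).choose r < r * 2 ^ r + 2 * Pnum r := by
  have hpos : 0 < 2 ^ r := by positivity
  rcases hr.eq_or_lt with rfl | hr
  · have := choose_le_Pnum_add_of_odd (r := 3) rfl
    omega
  · have hP := choose_le_Pnum_add r
    have hc := Nat.choose_lt_two_pow r (r / 2) (by omega)
    nlinarith

theorem alpha_upper_choose {r : ℕ} (hr : 3 ≤ r) :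
    r * 2 ^ r + 2 * Pnum r < r * (2 * r).choose r := by
  have hC : 2 ^ r < (2 * r).choose r := two_pow_lt_centralBinom (by omega)
  have hP : Pnum r + 2 ^ r ≤ (2 * r).choose r := by
    have := Pnum_le r
    omega
  nlinarith

/-- for `r ≥ 3`, `2·(2r)! < r·(2^r (r!)² + 2 P_r (r-1)! r!)` and
`2^r (r!)² + 2 P_r (r-1)! r! < (2r)!`; i.e. `2r/r² < α < 1`. -/
theorem alpha_bounds (r : ℕ) (hr : 3 ≤ r) :
    2 * (2 * r).factorial <
      r * (2 ^ r * r.factorial ^ 2 + 2 * Pnum r * (r - 1).factorial * r.factorial) ∧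
    2 ^ r * r.factorial ^ 2 + 2 * Pnum r * (r - 1).factorial * r.factorial <
      (2 * r).factorial := by
  have hfact : (2 * r).factorial = (2 * r).choose r * r.factorial ^ 2 := by
    rw [← Nat.choose_mul_factorial_mul_factorial (show r ≤ 2 * r by omega),
      show 2 * r - r = r by omega]
    ring
  have hsum : r * (2 ^ r * r.factorial ^ 2 + 2 * Pnum r * (r - 1).factorial * r.factorial) =
      (r * 2 ^ r + 2 * Pnum r) * r.factorial ^ 2 := by
    have h := Nat.mul_factorial_pred (show r ≠ 0 by omega)
    linear_combination 2 * Pnum r * r.factorial * h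
  have hpos : 0 < r.factorial ^ 2 := by positivity
  constructor
  · rw [hsum, hfact, ← mul_assoc]
    exact Nat.mul_lt_mul_of_pos_right (alpha_lower_choose hr) hpos
  · refine Nat.lt_of_mul_lt_mul_left (a := r) ?_
    rw [hsum, hfact, ← mul_assoc]
    exact Nat.mul_lt_mul_of_pos_right (alpha_upper_choose hr) hpos
end

section
/- Let r, t ≥ 2 and n = r + t. Delete from X³_{r,t} all edges {g,h} with hg⁻¹ = (r r+1). The resulting graph has exactly binomial(n,r) connected components, namely the sets V_A = {σ ∈ S_n : σ⁻¹({1,…,r}) = A} taken over all r-element subsets A of {1,…,n} (equivalently, the right cosets of the Young subgroup H = {σ : σ({1,…,r}) = {1,…,r}}), and the subgraph induced on each V_A is isomorphic to the Cartesian product of the star Cayley graph on S_r with center r and the star Cayley graph on S_t with center t. -/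
/-- Adjacency in the star Cayley graph: left multiplication by a transposition at the center. -/
theorem starGraph_adj {m : ℕ} {g h : Equiv.Perm (Fin m)} :
    (starGraph m).Adj g h ↔
      ∃ i j : Fin m, (i : ℕ) < m - 1 ∧ (j : ℕ) = m - 1 ∧ h * g⁻¹ = Equiv.swap i j := by
  rw [starGraph, SimpleGraph.fromRel_adj]
  constructor
  · rintro ⟨-, h₁ | ⟨i, j, hi, hj, e⟩⟩
    · exact h₁
    · refine ⟨i, j, hi, hj, ?_⟩
      have := congrArg (·⁻¹) e
      simpa using this
  · rintro ⟨i, j, hi, hj, e⟩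
    refine ⟨?_, Or.inl ⟨i, j, hi, hj, e⟩⟩
    rintro rfl
    rw [mul_inv_cancel, eq_comm, Equiv.swap_eq_one_iff] at e
    subst e
    omega

theorem starGraph_reachable_swap_mul {m : ℕ} (x y : Fin m) (g : Equiv.Perm (Fin m)) :
    (starGraph m).Reachable g (Equiv.swap x y * g) := by
  let c : Fin m := ⟨m - 1, by have := x.2; omega⟩
  have key : ∀ (z : Fin m) (k : Equiv.Perm (Fin m)),
      (starGraph m).Reachable k (Equiv.swap z c * k) := by
    intro z k
    by_cases hz : z = c
    · rw [hz, Equiv.swap_self, ← Equiv.Perm.one_def, one_mul]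
    · refine (starGraph_adj.2 ⟨z, c, ?_, rfl, by simp⟩).reachable
      have : (z : ℕ) ≠ m - 1 := fun h => hz (Fin.ext h)
      omega
  by_cases hxc : x = c
  · rw [hxc, Equiv.swap_comm]
    exact key y g
  by_cases hxy : x = y
  · rw [hxy, Equiv.swap_self, ← Equiv.Perm.one_def, one_mul]
  have e : Equiv.swap x y = Equiv.swap y c * Equiv.swap x c * Equiv.swap y c := by
    rw [Equiv.swap_comm y c, Equiv.swap_mul_swap_mul_swap hxc hxy, Equiv.swap_comm]
  rw [e, mul_assoc, mul_assoc]
  exact ((key y g).trans (key x _)).trans (key y _)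

theorem starGraph_connected (m : ℕ) : (starGraph m).Connected := by
  have h1 : ∀ g : Equiv.Perm (Fin m), (starGraph m).Reachable 1 g := by
    intro g
    induction g using Equiv.Perm.swap_induction_on with
    | one => exact .rfl
    | swap_mul f x y _ ih => exact ih.trans (starGraph_reachable_swap_mul x y f)
  exact ⟨fun g h => (h1 g).symm.trans (h1 h)⟩

/-- The blocks `Fin r` and `Fin t` placed in `Fin (r + t)`, the second one reversed, so that the
last elements of the two blocks become `r - 1` and `r`. -/
def blockEquiv (r t : ℕ) : Fin r ⊕ Fin t ≃ Fin (r + t) :=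
  (Equiv.sumCongr (Equiv.refl _) Fin.revPerm).trans finSumFinEquiv

theorem blockEquiv_inl_val {r t : ℕ} (i : Fin r) :
    ((blockEquiv r t (Sum.inl i) : Fin (r + t)) : ℕ) = i := by
  simp [blockEquiv]

theorem blockEquiv_inr_val {r t : ℕ} (j : Fin t) :
    ((blockEquiv r t (Sum.inr j) : Fin (r + t)) : ℕ) = r + (t - 1 - j) := by
  simp [blockEquiv, Fin.val_rev]
  omega

/-- The block-diagonal embedding `S_r × S_t → S_{r+t}` along `blockEquiv`. -/
def blockHom (r t : ℕ) :
    Equiv.Perm (Fin r) × Equiv.Perm (Fin t) →* Equiv.Perm (Fin (r + t)) :=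
  (blockEquiv r t).permCongrHom.toMonoidHom.comp (Equiv.Perm.sumCongrHom (Fin r) (Fin t))

theorem blockHom_injective (r t : ℕ) : Function.Injective (blockHom r t) :=
  (blockEquiv r t).permCongrHom.injective.comp Equiv.Perm.sumCongrHom_injective

theorem blockHom_apply {r t : ℕ} (p : Equiv.Perm (Fin r) × Equiv.Perm (Fin t)) (x : Fin (r + t)) :
    blockHom r t p x =
      blockEquiv r t (Sum.map p.1 p.2 ((blockEquiv r t).symm x)) := rfl

theorem blockHom_swap_one {r t : ℕ} (i j : Fin r) :
    blockHom r t (Equiv.swap i j, 1) =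
      Equiv.swap (blockEquiv r t (Sum.inl i)) (blockEquiv r t (Sum.inl j)) := by
  change (blockEquiv r t).permCongr (Equiv.Perm.sumCongr (Equiv.swap i j) 1) = _
  rw [Equiv.Perm.sumCongr_swap_one]
  ext x
  simp [Equiv.permCongr_def, Equiv.symm_trans_swap_trans]

theorem blockHom_one_swap {r t : ℕ} (i j : Fin t) :
    blockHom r t (1, Equiv.swap i j) =
      Equiv.swap (blockEquiv r t (Sum.inr i)) (blockEquiv r t (Sum.inr j)) := by
  change (blockEquiv r t).permCongr (Equiv.Perm.sumCongr 1 (Equiv.swap i j)) = _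
  rw [Equiv.Perm.sumCongr_one_swap]
  ext x
  simp [Equiv.permCongr_def, Equiv.symm_trans_swap_trans]

theorem blockEquiv_val_lt {r t : ℕ} (x : Fin r ⊕ Fin t) :
    ((blockEquiv r t x : Fin (r + t)) : ℕ) < r ↔ x.isLeft := by
  cases x <;> simp [blockEquiv_inl_val, blockEquiv_inr_val]

theorem blockHom_apply_val_lt {r t : ℕ} (p : Equiv.Perm (Fin r) × Equiv.Perm (Fin t))
    (x : Fin (r + t)) : (blockHom r t p x : ℕ) < r ↔ (x : ℕ) < r := by
  obtain ⟨y, rfl⟩ := (blockEquiv r t).surjective x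
  rw [blockHom_apply, blockEquiv_val_lt, blockEquiv_val_lt]
  cases y <;> simp

theorem exists_blockHom_eq {r t : ℕ} {σ : Equiv.Perm (Fin (r + t))}
    (hσ : ∀ x, (σ x : ℕ) < r ↔ (x : ℕ) < r) : ∃ p, blockHom r t p = σ := by
  have : (blockEquiv r t).permCongrHom.symm σ ∈
      (Equiv.Perm.sumCongrHom (Fin r) (Fin t)).range := by
    apply Equiv.Perm.mem_sumCongrHom_range_of_perm_mapsTo_inl
    rintro _ ⟨i, rfl⟩
    have h := (hσ (blockEquiv r t (Sum.inl i))).2 (by simp [blockEquiv_inl_val])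
    obtain ⟨y, hy⟩ := (blockEquiv r t).surjective (σ (blockEquiv r t (Sum.inl i)))
    rw [← hy, blockEquiv_val_lt] at h
    change (blockEquiv r t).symm (σ (blockEquiv r t (Sum.inl i))) ∈ _
    rw [← hy, Equiv.symm_apply_apply]
    exact Sum.isLeft_iff.1 h |>.imp fun _ => Eq.symm
  obtain ⟨p, hp⟩ := this
  exact ⟨p, (congrArg (blockEquiv r t).permCongrHom hp).trans
    ((blockEquiv r t).permCongrHom.apply_symm_apply σ)⟩

theorem exists_perm_val_lt_iff_mem {r t : ℕ} {A : Finset (Fin (r + t))} (hA : A.card = r) :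
    ∃ s : Equiv.Perm (Fin (r + t)), ∀ x, (s x : ℕ) < r ↔ x ∈ A := by
  have e : {x // x ∈ A} ≃ {x : Fin (r + t) // (x : ℕ) < r} := by
    refine Fintype.equivOfCardEq ?_
    rw [Fintype.card_coe, hA, ← Fintype.card_congr (Fin.castLEquiv (Nat.le_add_right r t)),
      Fintype.card_fin]
  refine ⟨e.extendSubtype, fun x => ?_⟩
  by_cases hx : x ∈ A
  · simpa [hx] using e.extendSubtype_mem x hx
  · simpa [hx] using e.extendSubtype_not_mem x hx

theorem mul_inv_eq_swap_comm {α : Type*} [DecidableEq α] {g h : Equiv.Perm α} {i j : α} :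
    h * g⁻¹ = Equiv.swap i j ↔ g * h⁻¹ = Equiv.swap i j := by
  rw [← inv_inj, Equiv.swap_inv, mul_inv_rev, inv_inv]

theorem boxProd_starGraph_adj_iff_adj_one {r t : ℕ}
    (p q : Equiv.Perm (Fin r) × Equiv.Perm (Fin t)) :
    ((starGraph r).boxProd (starGraph t)).Adj p q ↔
      ((starGraph r).boxProd (starGraph t)).Adj 1 (q * p⁻¹) := by
  simp only [SimpleGraph.boxProd_adj, starGraph_adj, Prod.fst_mul, Prod.snd_mul, Prod.fst_inv,
    Prod.snd_inv, Prod.fst_one, Prod.snd_one, inv_one, mul_one,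
    eq_comm (a := (1 : Equiv.Perm (Fin r))), eq_comm (a := (1 : Equiv.Perm (Fin t))),
    mul_inv_eq_one, eq_comm (a := p.1), eq_comm (a := p.2)]

/-- Deleting the central color leaves left multiplication by the edges of one of the two stars. -/
theorem fromRel_doubleStar_adj {r t : ℕ} (hr : 2 ≤ r) (ht : 2 ≤ t)
    (hl : r - 1 < r + t) (hc : r < r + t)
    {g h : Equiv.Perm (Fin (r + t))} :
    (SimpleGraph.fromRel fun g h : Equiv.Perm (Fin (r + t)) =>
      (∃ i j : Fin (r + t), (doubleStar r t).Adj i j ∧ h * g⁻¹ = Equiv.swap i j) ∧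
        h * g⁻¹ ≠ Equiv.swap ⟨r - 1, hl⟩ ⟨r, hc⟩).Adj g h ↔
      ∃ p : Equiv.Perm (Fin r) × Equiv.Perm (Fin t),
        ((starGraph r).boxProd (starGraph t)).Adj 1 p ∧ blockHom r t p = h * g⁻¹ := by
  have noncentral : ∀ i j : Fin (r + t),
      (((i : ℕ) < r - 1 ∧ (j : ℕ) = r - 1) ∨ ((i : ℕ) = r - 1 ∧ (j : ℕ) = r) ∨
        ((i : ℕ) = r ∧ r < (j : ℕ))) →
      Equiv.swap i j ≠ Equiv.swap ⟨r - 1, hl⟩ ⟨r, hc⟩ →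
      ∃ p : Equiv.Perm (Fin r) × Equiv.Perm (Fin t),
        ((starGraph r).boxProd (starGraph t)).Adj 1 p ∧ blockHom r t p = Equiv.swap i j := by
    rintro i j (⟨hi, hj⟩ | ⟨hi, hj⟩ | ⟨hi, hj⟩) hne
    · refine ⟨(Equiv.swap ⟨i, by omega⟩ ⟨j, by omega⟩, 1),
        Or.inl ⟨starGraph_adj.2 ⟨⟨i, by omega⟩, ⟨j, by omega⟩, hi, hj, by simp⟩, rfl⟩, ?_⟩
      rw [blockHom_swap_one]
      congr 1
    · exact absurd (by congr 1 <;> ext <;> assumption) hne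
    · have := j.2
      refine ⟨(1, Equiv.swap ⟨r + t - 1 - j, by omega⟩ ⟨t - 1, by omega⟩),
        Or.inr ⟨starGraph_adj.2 ⟨⟨r + t - 1 - j, by omega⟩, ⟨t - 1, by omega⟩,
          by simp only; omega, rfl, by simp⟩, rfl⟩, ?_⟩
      rw [blockHom_one_swap, Equiv.swap_comm]
      congr 1 <;> ext <;> simp only [blockEquiv_inr_val] <;> omega
  have ne_central : ∀ i j : Fin (r + t), ((i : ℕ) < r ↔ (j : ℕ) < r) →
      Equiv.swap i j ≠ Equiv.swap ⟨r - 1, hl⟩ ⟨r, hc⟩ := by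
    intro i j hij e
    have h1 := congrArg (fun f : Equiv.Perm (Fin (r + t)) => (f ⟨r, hc⟩ : ℕ)) e
    simp only [Equiv.swap_apply_right, Equiv.swap_apply_def] at h1
    split_ifs at h1 with h2 h3
    · rw [Fin.ext_iff] at h2
      simp only at h2
      omega
    · rw [Fin.ext_iff] at h3
      simp only at h3
      omega
    · simp only at h1
      omega
  rw [SimpleGraph.fromRel_adj]
  constructor
  · intro ⟨_, hrel⟩
    obtain ⟨⟨i, j, hij, e⟩, hne⟩ :
        (∃ i j : Fin (r + t), (doubleStar r t).Adj i j ∧ h * g⁻¹ = Equiv.swap i j) ∧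
          h * g⁻¹ ≠ Equiv.swap ⟨r - 1, hl⟩ ⟨r, hc⟩ := by
      rcases hrel with hrel | ⟨⟨i, j, hij, e⟩, hne⟩
      · exact hrel
      · exact ⟨⟨i, j, hij, mul_inv_eq_swap_comm.1 e⟩, fun e' => hne (mul_inv_eq_swap_comm.1 e')⟩
    rw [e] at hne ⊢
    rw [doubleStar, SimpleGraph.fromRel_adj] at hij
    rcases hij.2 with hD | hD
    · exact noncentral i j hD hne
    · rw [Equiv.swap_comm] at hne ⊢
      exact noncentral j i hD hne
  · rintro ⟨p, hp, e⟩
    have hgh : g ≠ h := by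
      rintro rfl
      rw [mul_inv_cancel, ← map_one (blockHom r t)] at e
      exact hp.ne (blockHom_injective r t e).symm
    refine ⟨hgh, Or.inl ?_⟩
    rw [← e]
    obtain ⟨a, b⟩ := p
    rcases hp with ⟨ha, hb⟩ | ⟨hb, ha⟩
    · obtain ⟨i, j, hi, hj, hs⟩ := starGraph_adj.1 ha
      obtain rfl : 1 = b := hb
      obtain rfl : a = Equiv.swap i j := by simpa using hs
      rw [blockHom_swap_one]
      refine ⟨⟨_, _, ?_, rfl⟩, ne_central _ _ (by simp [blockEquiv_inl_val])⟩
      rw [doubleStar, SimpleGraph.fromRel_adj, Ne, Fin.ext_iff]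
      simp only [blockEquiv_inl_val]
      omega
    · obtain ⟨i, j, hi, hj, hs⟩ := starGraph_adj.1 hb
      obtain rfl : 1 = a := ha
      obtain rfl : b = Equiv.swap i j := by simpa using hs
      rw [blockHom_one_swap]
      refine ⟨⟨_, _, ?_, rfl⟩, ne_central _ _ (by simp [blockEquiv_inr_val])⟩
      rw [doubleStar, SimpleGraph.fromRel_adj, Ne, Fin.ext_iff]
      simp only [blockEquiv_inr_val]
      omega

/-- deleting from `X³_{r,t}` the edges colored by the central transposition
`(r, r+1)` leaves exactly `binomial(n,r)` components, namely the sets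
`V_A = {σ | σ⁻¹({1,…,r}) = A}`, each inducing a graph isomorphic to the Cartesian
product of the two star Cayley graphs. -/
theorem components_of_deleted_graph (r t : ℕ) (hr : 2 ≤ r) (ht : 2 ≤ t)
    (G' : SimpleGraph (Equiv.Perm (Fin (r + t))))
    (hG' : G' = SimpleGraph.fromRel fun g h =>
      (∃ i j : Fin (r + t), (doubleStar r t).Adj i j ∧ h * g⁻¹ = Equiv.swap i j) ∧
        h * g⁻¹ ≠ Equiv.swap ⟨r - 1, by omega⟩ ⟨r, by omega⟩) :
    Nat.card G'.ConnectedComponent = (r + t).choose r ∧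
    (∀ g h : Equiv.Perm (Fin (r + t)),
      G'.Reachable g h ↔ ∀ i : Fin (r + t), ((g i : ℕ) < r ↔ (h i : ℕ) < r)) ∧
    ∀ A : Finset (Fin (r + t)), A.card = r →
      Nonempty ((G'.induce {σ | ∀ i : Fin (r + t), ((σ i : ℕ) < r ↔ i ∈ A)}) ≃g
        (starGraph r).boxProd (starGraph t)) := by
  have hadj : ∀ g h, G'.Adj g h ↔ ∃ p : Equiv.Perm (Fin r) × Equiv.Perm (Fin t),
      ((starGraph r).boxProd (starGraph t)).Adj 1 p ∧ blockHom r t p = h * g⁻¹ := by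
    subst hG'
    exact fun g h => fromRel_doubleStar_adj hr ht _ _
  have hiso : ∀ A : Finset (Fin (r + t)), A.card = r →
      Nonempty ((G'.induce {σ | ∀ i : Fin (r + t), ((σ i : ℕ) < r ↔ i ∈ A)}) ≃g
        (starGraph r).boxProd (starGraph t)) := by
    intro A hA
    obtain ⟨s, hs⟩ := exists_perm_val_lt_iff_mem hA
    let f : Equiv.Perm (Fin r) × Equiv.Perm (Fin t) →
        {σ : Equiv.Perm (Fin (r + t)) | ∀ i : Fin (r + t), ((σ i : ℕ) < r ↔ i ∈ A)} :=
      fun p => ⟨blockHom r t p * s, fun i => by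
        rw [Equiv.Perm.mul_apply, blockHom_apply_val_lt, hs]⟩
    have hf : Function.Bijective f := by
      constructor
      · intro p q hpq
        exact blockHom_injective r t (mul_right_cancel (Subtype.ext_iff.1 hpq))
      · rintro ⟨σ, hσ⟩
        obtain ⟨p, hp⟩ := exists_blockHom_eq (σ := σ * s⁻¹) fun x => by
          rw [Equiv.Perm.mul_apply, hσ, ← hs, ← Equiv.Perm.mul_apply, mul_inv_cancel,
            Equiv.Perm.one_apply]
        exact ⟨p, Subtype.ext (by simp [f, hp])⟩
    refine ⟨SimpleGraph.Iso.symm ⟨Equiv.ofBijective f hf, ?_⟩⟩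
    intro p q
    rw [SimpleGraph.induce_adj, hadj, boxProd_starGraph_adj_iff_adj_one]
    have e : (f q : Equiv.Perm (Fin (r + t))) * (f p : Equiv.Perm (Fin (r + t)))⁻¹ =
        blockHom r t (q * p⁻¹) := by
      simp [f, mul_assoc]
    change (∃ x, _ ∧ _ = (f q : Equiv.Perm (Fin (r + t))) * (f p : Equiv.Perm (Fin (r + t)))⁻¹) ↔ _
    simp only [e, (blockHom_injective r t).eq_iff, exists_eq_right]
  let block : Equiv.Perm (Fin (r + t)) → Finset (Fin (r + t)) :=
    fun g => Finset.univ.filter fun i => (g i : ℕ) < r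
  have hblock : ∀ g i, i ∈ block g ↔ (g i : ℕ) < r := fun g i => by simp [block]
  have hcard : ∀ g, (block g).card = r := by
    intro g
    rw [← Fintype.card_coe,
      Fintype.card_congr (g.subtypeEquiv (q := fun x : Fin (r + t) => (x : ℕ) < r) (hblock g)),
      ← Fintype.card_congr (Fin.castLEquiv (Nat.le_add_right r t)), Fintype.card_fin]
  have hreach : ∀ g h : Equiv.Perm (Fin (r + t)),
      G'.Reachable g h ↔ ∀ i : Fin (r + t), ((g i : ℕ) < r ↔ (h i : ℕ) < r) := by
    intro g h
    constructor
    · rintro ⟨w⟩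
      induction w with
      | nil => exact fun _ => Iff.rfl
      | cons hxy _ ih =>
        intro i
        obtain ⟨p, -, e⟩ := (hadj _ _).1 hxy
        rw [← ih i, mul_inv_eq_iff_eq_mul.1 e.symm, Equiv.Perm.mul_apply, blockHom_apply_val_lt]
    · intro hgh
      obtain ⟨φ⟩ := hiso (block g) (hcard g)
      have hconn := φ.connected_iff.2 ((starGraph_connected r).boxProd (starGraph_connected t))
      exact (hconn ⟨g, fun i => (hblock g i).symm⟩
        ⟨h, fun i => ((hblock g i).trans (hgh i)).symm⟩).map
          (SimpleGraph.Embedding.induce _).toHom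
  refine ⟨?_, hreach, hiso⟩
  have hblock_eq : ∀ g h, block g = block h ↔ G'.Reachable g h := by
    intro g h
    simp only [hreach, Finset.ext_iff, hblock]
  let F : G'.ConnectedComponent → {A : Finset (Fin (r + t)) // A.card = r} :=
    Quot.lift (fun g => ⟨block g, hcard g⟩) fun g h hgh => Subtype.ext ((hblock_eq g h).2 hgh)
  have hF : Function.Bijective F := by
    constructor
    · rintro ⟨g⟩ ⟨h⟩ hgh
      exact Quot.sound ((hblock_eq g h).1 (Subtype.ext_iff.1 hgh))
    · rintro ⟨A, hA⟩
      obtain ⟨s, hs⟩ := exists_perm_val_lt_iff_mem hA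
      exact ⟨G'.connectedComponentMk s, Subtype.ext (Finset.ext fun i => (hblock s i).trans (hs i))⟩
  rw [Nat.card_congr (Equiv.ofBijective F hF), Nat.card_eq_fintype_card, Fintype.card_finset_len,
    Fintype.card_fin]
end

section
/- For integers r ≥ 0 and k ≥ 0, the number of words of length 2r over the alphabet {U, D} containing exactly r letters U and r letters D, and containing exactly k occurrences of the consecutive factor UUD, equals binomial(r,2k)·2^{r−2k}·binomial(2k,k). -/
/-- The number of occurrences of the factor `UUD` in a word (`U = true`, `D = false`). -/
def countUUD : List Bool → ℕ
  | [] => 0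
  | a :: l => (if [true, true, false] <+: a :: l then 1 else 0) + countUUD l

lemma countUUD_false_cons (l : List Bool) : countUUD (false :: l) = countUUD l := by
  simp [countUUD]

lemma countUUD_true_false_cons (l : List Bool) :
    countUUD (true :: false :: l) = countUUD l := by
  simp [countUUD]

lemma countUUD_true_true_false_cons (l : List Bool) :
    countUUD (true :: true :: false :: l) = countUUD l + 1 := by
  simp [countUUD, add_comm]

lemma countUUD_true_true_true_cons (l : List Bool) :
    countUUD (true :: true :: true :: l) = countUUD (true :: true :: l) := by
  simp [countUUD]

lemma countUUD_replicate_true (n : ℕ) : countUUD (List.replicate n true) = 0 := by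
  induction n with
  | zero => rfl
  | succ n ih =>
    rw [List.replicate_succ, countUUD, ih, if_neg]
    intro h
    rw [← List.replicate_succ] at h
    have := List.eq_of_mem_replicate (h.subset (show false ∈ [true, true, false] by simp))
    simp at this

/-- The words with `u` letters `U` and `d` letters `D` which, preceded by `s` letters `U`,
contain exactly `k` occurrences of `UUD`. -/
def wordsUUD (s u d k : ℕ) : Set (List Bool) :=
  {l | l.count true = u ∧ l.count false = d ∧ countUUD (List.replicate s true ++ l) = k}

lemma length_eq_of_count {l : List Bool} {u d : ℕ} (hu : l.count true = u)
    (hd : l.count false = d) : l.length = u + d := by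
  rw [← hu, ← hd, List.count_true_add_count_false]

lemma finite_wordsUUD (s u d k : ℕ) : (wordsUUD s u d k).Finite :=
  (List.finite_length_eq Bool (u + d)).subset fun _ hl => length_eq_of_count hl.1 hl.2.1

lemma wordsUUD_no_down (s u k : ℕ) :
    wordsUUD s u 0 k = if k = 0 then {List.replicate u true} else ∅ := by
  have key : ∀ l, l ∈ wordsUUD s u 0 k ↔ l = List.replicate u true ∧ k = 0 := by
    intro l
    constructor
    · rintro ⟨hu, hd, hk⟩
      have hl : l = List.replicate u true := by
        rw [List.eq_replicate_iff]
        refine ⟨length_eq_of_count hu hd, fun b hb => ?_⟩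
        cases b
        · exact absurd hb (List.count_eq_zero.1 hd)
        · rfl
      subst hl
      rw [List.replicate_append_replicate, countUUD_replicate_true] at hk
      exact ⟨rfl, hk.symm⟩
    · rintro ⟨rfl, rfl⟩
      refine ⟨by simp, by simp [List.count_replicate], ?_⟩
      rw [List.replicate_append_replicate, countUUD_replicate_true]
  ext l
  rw [key]
  split_ifs with h <;> simp [h]

/-- Splitting words by their first letter. -/
lemma ncard_wordsUUD_eq_add (s u d k : ℕ) :
    (wordsUUD s u d k).ncard =
      {l | true :: l ∈ wordsUUD s u d k}.ncard + {l | false :: l ∈ wordsUUD s u d k}.ncard +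
        {l | l = [] ∧ l ∈ wordsUUD s u d k}.ncard := by
  have hf := finite_wordsUUD s u d k
  have hT : (List.cons true '' {l | true :: l ∈ wordsUUD s u d k}) ⊆ wordsUUD s u d k := by
    rintro _ ⟨l, hl, rfl⟩; exact hl
  have hF : (List.cons false '' {l | false :: l ∈ wordsUUD s u d k}) ⊆ wordsUUD s u d k := by
    rintro _ ⟨l, hl, rfl⟩; exact hl
  have hE : {l | l = [] ∧ l ∈ wordsUUD s u d k} ⊆ wordsUUD s u d k := fun l hl => hl.2
  rw [← Set.ncard_image_of_injective {l | true :: l ∈ _} (List.cons_injective (a := true)),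
    ← Set.ncard_image_of_injective {l | false :: l ∈ _} (List.cons_injective (a := false)),
    ← Set.ncard_union_eq _ (hf.subset hT) (hf.subset hF),
    ← Set.ncard_union_eq _ (hf.subset (Set.union_subset hT hF)) (hf.subset hE)]
  · congr 1
    refine Set.Subset.antisymm ?_ (Set.union_subset (Set.union_subset hT hF) hE)
    rintro (_ | ⟨_ | _, l⟩) hl
    · exact Or.inr ⟨rfl, hl⟩
    · exact Or.inl (Or.inr ⟨l, hl, rfl⟩)
    · exact Or.inl (Or.inl ⟨l, hl, rfl⟩)
  · rw [Set.disjoint_left]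
    rintro _ (⟨l, -, rfl⟩ | ⟨l, -, rfl⟩) ⟨h, -⟩ <;> simp at h
  · rw [Set.disjoint_left]
    rintro _ ⟨l, -, rfl⟩ ⟨m, -, h⟩
    simp at h

lemma true_cons_mem_wordsUUD_succ (s u d k : ℕ) :
    {l | true :: l ∈ wordsUUD s (u + 1) d k} = wordsUUD (s + 1) u d k := by
  ext l
  simp [wordsUUD, List.replicate_succ', List.append_assoc]

lemma true_cons_mem_wordsUUD_zero (s d k : ℕ) :
    {l | true :: l ∈ wordsUUD s 0 d k} = ∅ := by
  ext l
  simp [wordsUUD]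

lemma nil_mem_wordsUUD_succ (s u d k : ℕ) :
    {l | l = [] ∧ l ∈ wordsUUD s u (d + 1) k} = ∅ := by
  ext l
  simp only [wordsUUD, Set.mem_ofPred_eq, Set.mem_empty_iff_false, iff_false]
  rintro ⟨rfl, -, h, -⟩
  simp at h

lemma wordsUUD_three (u d k : ℕ) : wordsUUD 3 u d k = wordsUUD 2 u d k := by
  ext l
  simp [wordsUUD, List.replicate_succ, countUUD_true_true_true_cons]

lemma false_cons_mem_wordsUUD_zero (u d k : ℕ) :
    {l | false :: l ∈ wordsUUD 0 u (d + 1) k} = wordsUUD 0 u d k := by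
  ext l
  simp [wordsUUD, countUUD_false_cons]

lemma false_cons_mem_wordsUUD_one (u d k : ℕ) :
    {l | false :: l ∈ wordsUUD 1 u (d + 1) k} = wordsUUD 0 u d k := by
  ext l
  simp [wordsUUD, countUUD_true_false_cons]

lemma false_cons_mem_wordsUUD_two_zero (u d : ℕ) :
    {l | false :: l ∈ wordsUUD 2 u (d + 1) 0} = ∅ := by
  ext l
  simp [wordsUUD, List.replicate_succ, countUUD_true_true_false_cons]

lemma false_cons_mem_wordsUUD_two_succ (u d k : ℕ) :
    {l | false :: l ∈ wordsUUD 2 u (d + 1) (k + 1)} = wordsUUD 0 u d k := by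
  ext l
  simp [wordsUUD, List.replicate_succ, countUUD_true_true_false_cons]

/-- The generating function of `wordsUUD` by number of letters `U`. -/
noncomputable def seriesUUD (s d k : ℕ) : PowerSeries ℤ :=
  PowerSeries.mk fun u => ((wordsUUD s u d k).ncard : ℤ)

section Series
open PowerSeries

lemma seriesUUD_no_down (s k : ℕ) :
    seriesUUD s 0 k = if k = 0 then PowerSeries.mk 1 else 0 := by
  ext u
  simp only [seriesUUD, coeff_mk, wordsUUD_no_down]
  split_ifs <;> simp

lemma seriesUUD_succ (s d k : ℕ) :
    seriesUUD s (d + 1) k = X * seriesUUD (s + 1) (d + 1) k +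
      PowerSeries.mk fun u => ({l | false :: l ∈ wordsUUD s u (d + 1) k}.ncard : ℤ) := by
  ext u
  rw [map_add, seriesUUD, coeff_mk, coeff_mk, ncard_wordsUUD_eq_add, nil_mem_wordsUUD_succ]
  cases u with
  | zero => simp [true_cons_mem_wordsUUD_zero]
  | succ u => simp [true_cons_mem_wordsUUD_succ, coeff_succ_X_mul, seriesUUD]

lemma seriesUUD_three (d k : ℕ) : seriesUUD 3 d k = seriesUUD 2 d k := by
  simp only [seriesUUD, wordsUUD_three]

lemma seriesUUD_two_succ_zero (d : ℕ) : seriesUUD 2 (d + 1) 0 = 0 := by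
  have h := seriesUUD_succ 2 d 0
  have h0 : (PowerSeries.mk fun _ => 0 : PowerSeries ℤ) = 0 := rfl
  simp only [false_cons_mem_wordsUUD_two_zero, seriesUUD_three, Set.ncard_empty, Nat.cast_zero,
    h0, Nat.reduceAdd] at h
  linear_combination (PowerSeries.mk 1 : PowerSeries ℤ) * h -
    seriesUUD 2 (d + 1) 0 * mk_one_mul_one_sub_eq_one ℤ

lemma seriesUUD_two_succ_succ (d k : ℕ) :
    seriesUUD 2 (d + 1) (k + 1) = PowerSeries.mk 1 * seriesUUD 0 d k := by
  have h := seriesUUD_succ 2 d (k + 1)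
  simp only [false_cons_mem_wordsUUD_two_succ, seriesUUD_three, Nat.reduceAdd] at h
  change _ = _ + seriesUUD 0 d k at h
  linear_combination (PowerSeries.mk 1 : PowerSeries ℤ) * h -
    seriesUUD 2 (d + 1) (k + 1) * mk_one_mul_one_sub_eq_one ℤ

lemma seriesUUD_zero_succ (d k : ℕ) :
    seriesUUD 0 (d + 1) k = (1 + X) * seriesUUD 0 d k + X ^ 2 * seriesUUD 2 (d + 1) k := by
  have h0 := seriesUUD_succ 0 d k
  have h1 := seriesUUD_succ 1 d k
  simp only [false_cons_mem_wordsUUD_zero, false_cons_mem_wordsUUD_one, Nat.reduceAdd] at h0 h1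
  change _ = _ + seriesUUD 0 d k at h0
  change _ = _ + seriesUUD 0 d k at h1
  rw [h0, h1]
  ring

lemma seriesUUD_zero_eq (d k : ℕ) :
    seriesUUD 0 d k =
      (d.choose k : PowerSeries ℤ) * (1 + X) ^ (d - k) * X ^ (2 * k) *
        PowerSeries.mk 1 ^ (k + 1) := by
  induction d generalizing k with
  | zero => cases k <;> simp [seriesUUD_no_down]
  | succ d ih =>
    rw [seriesUUD_zero_succ, ih]
    cases k with
    | zero =>
      rw [seriesUUD_two_succ_zero]
      simp only [Nat.choose_zero_right, Nat.sub_zero]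
      ring
    | succ k =>
      rw [seriesUUD_two_succ_succ, ih, Nat.choose_succ_succ, Nat.add_sub_add_right]
      rcases lt_or_ge d (k + 1) with h | h
      · rw [Nat.choose_eq_zero_of_lt h]
        push_cast
        ring
      · obtain ⟨m, rfl⟩ := Nat.exists_eq_add_of_le h
        rw [show k + 1 + m - (k + 1) = m by omega, show k + 1 + m - k = m + 1 by omega]
        push_cast
        ring

end Series

lemma ncard_wordsUUD_balanced (r k : ℕ) :
    (wordsUUD 0 r r k).ncard = r.choose (2 * k) * 2 ^ (r - 2 * k) * (2 * k).choose k := by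
  have h : PowerSeries.coeff r (seriesUUD 0 r k) = ((wordsUUD 0 r r k).ncard : ℤ) := by
    rw [seriesUUD, PowerSeries.coeff_mk]
  rw [← @Nat.cast_inj ℤ, ← h, seriesUUD_zero_eq, mul_right_comm _ (_ ^ (2 * k)),
    mul_comm _ (PowerSeries.X ^ (2 * k)), PowerSeries.coeff_X_pow_mul', mul_assoc]
  split_ifs with hk
  · obtain ⟨n, rfl⟩ := Nat.exists_eq_add_of_le hk
    have hterm : ∀ p ∈ Finset.HasAntidiagonal.antidiagonal n,
        (2 * k + n - k).choose p.1 * (k + p.2).choose k = (n + k).choose k * n.choose p.1 := by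
      rintro ⟨i, j⟩ hij
      obtain rfl : i + j = n := by simpa using hij
      have e := Nat.choose_mul (n := i + j + k) (k := i + k) (s := k) (by omega)
      have e' := Nat.choose_mul (n := i + j + k) (k := i + k) (s := i) (by omega)
      rw [show i + j + k - k = i + j by omega, show i + k - k = i by omega] at e
      rw [show i + j + k - i = k + j by omega, show i + k - i = k by omega] at e'
      rw [show 2 * k + (i + j) - k = i + j + k by omega, ← e, ← e',
        Nat.choose_symm_add]
    have e := Nat.choose_mul (n := 2 * k + n) (k := 2 * k) (s := k) (by omega)
    rw [show 2 * k + n - k = n + k by omega, show 2 * k - k = k by omega] at e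
    rw [Nat.add_sub_cancel_left, ← map_natCast (PowerSeries.C (R := ℤ)), PowerSeries.coeff_C_mul,
      PowerSeries.mk_one_pow_eq_mk_choose_add, PowerSeries.coeff_mul]
    have hcoeff : ∀ i m, PowerSeries.coeff i ((1 + PowerSeries.X : PowerSeries ℤ) ^ m) =
        (m.choose i : ℤ) := by
      intro i m
      have := Polynomial.coeff_one_add_X_pow ℤ m i
      rw [← Polynomial.coeff_coe] at this
      simpa using this
    simp only [hcoeff, PowerSeries.coeff_mk]
    norm_cast
    rw [Finset.sum_congr rfl hterm, ← Finset.mul_sum, Finset.Nat.sum_antidiagonal_eq_sum_range_succ_mk,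
      Nat.sum_range_choose, ← mul_assoc, ← e]
    ring
  · rw [Nat.choose_eq_zero_of_lt (by omega : r < 2 * k)]
    simp

lemma ncard_factor_positions (l : List Bool) :
    {p : ℕ | ∃ h : p + 2 < l.length, l[p] = true ∧ l[p + 1] = true ∧ l[p + 2] = false}.ncard =
      countUUD l := by
  induction l with
  | nil => simp [countUUD]
  | cons a l ih =>
    set A := {p : ℕ | ∃ h : p + 2 < l.length, l[p] = true ∧ l[p + 1] = true ∧ l[p + 2] = false}
      with hA
    have hfin : A.Finite := (Set.finite_lt_nat l.length).subset fun p hp => by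
      obtain ⟨h, -⟩ := hp
      exact (by omega : p < l.length)
    rw [countUUD, ← ih, ← Set.ncard_image_of_injective A Nat.succ_injective]
    split_ifs with h
    · rw [add_comm, ← Set.ncard_insert_of_notMem (a := 0) (by simp) (hfin.image _)]
      congr 1
      obtain ⟨m, hm⟩ := h
      ext (_ | p)
      · simp [← hm]
      · simp [hA, Nat.succ_le_iff, Nat.add_right_comm p 1 1]
    · rw [zero_add]
      congr 1
      ext (_ | p)
      · simp only [Set.mem_ofPred_eq, Set.mem_image, Nat.succ_ne_zero, and_false, exists_false,
          iff_false]
        rintro ⟨h', h1, h2, h3⟩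
        apply h
        match l, h' with
        | b :: c :: m, _ =>
          simp at h1 h2 h3
          simp [h1, h2, h3]
      · simp [hA, Nat.succ_le_iff, Nat.add_right_comm p 1 1]

lemma ncard_true_eq_count_ofFn {n : ℕ} (w : Fin n → Bool) :
    {i | w i = true}.ncard = (List.ofFn w).count true := by
  rw [Set.ncard_eq_toFinset_card', Set.toFinset_ofPred]
  induction n with
  | zero => simp
  | succ n ih =>
    rw [Fin.card_filter_univ_succ, List.ofFn_succ, List.count_cons, ← ih]
    simp only [beq_iff_eq]
    split_ifs <;> rfl

/-- the number of words of length `2r` over `{U, D}` (here `U = true`,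
`D = false`) with `r` letters `U` and exactly `k` occurrences of the factor `UUD` is
`binomial(r,2k)·2^(r-2k)·binomial(2k,k)` (OEIS A051288). -/
theorem count_UD_words_with_k_UUD (r k : ℕ) :
    {w : Fin (r + r) → Bool | {i | w i = true}.ncard = r ∧
        {p : ℕ | ∃ h : p + 2 < r + r, w ⟨p, by omega⟩ = true ∧
          w ⟨p + 1, by omega⟩ = true ∧ w ⟨p + 2, h⟩ = false}.ncard = k}.ncard =
      r.choose (2 * k) * 2 ^ (r - 2 * k) * (2 * k).choose k := by
  rw [← ncard_wordsUUD_balanced, ← Set.ncard_image_of_injective _ List.ofFn_injective]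
  congr 1
  ext l
  constructor
  · rintro ⟨w, ⟨hw, hk⟩, rfl⟩
    rw [ncard_true_eq_count_ofFn] at hw
    have hlen := List.count_true_add_count_false (List.ofFn w)
    rw [List.length_ofFn] at hlen
    refine ⟨hw, by omega, ?_⟩
    rw [List.replicate_zero, List.nil_append, ← ncard_factor_positions, ← hk]
    simp
  · rintro ⟨hu, hd, hk⟩
    have hlen := length_eq_of_count hu hd
    obtain ⟨w, rfl⟩ : ∃ w : Fin (r + r) → Bool, List.ofFn w = l := by
      rw [← hlen]
      exact ⟨l.get, List.ofFn_get l⟩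
    refine ⟨w, ⟨?_, ?_⟩, rfl⟩
    · rw [ncard_true_eq_count_ofFn, hu]
    · rw [List.replicate_zero, List.nil_append, ← ncard_factor_positions] at hk
      rw [← hk]
      simp
end

section
/- In the Johnson graph Γ⁴₇ (vertices the 4-element subsets of {1,…,7}), the three 7-cycles φ₁ = ({1,2,3,4},{2,3,4,5},{3,4,5,6},{4,5,6,7},{5,6,7,1},{6,7,1,2},{7,1,2,3}), φ₂ = ({1,3,5,7},{3,5,7,2},{5,7,2,4},{7,2,4,6},{2,4,6,1},{4,6,1,3},{6,1,3,5}), φ₃ = ({1,4,7,3},{4,7,3,6},{7,3,6,2},{3,6,2,5},{6,2,5,1},{2,5,1,4},{5,1,4,7}), together with the 14-cycle ({1,2,3,5},{1,3,4,5},{4,5,6,1},{4,6,7,1},{7,1,2,4},{7,2,3,4},{3,4,5,7},{3,5,6,7},{6,7,1,3},{6,1,2,3},{2,3,4,6},{2,4,5,6},{5,6,7,2},{5,7,1,2}), form four pairwise vertex-disjoint cycles whose union is an exact spanning 2-regular subgraph (an exact 2-factor) of Γ⁴₇, covering all 35 vertices. -/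
/-- The triples of consecutive entries of a cyclically ordered list. -/
def cycleTriples {α : Type*} (l : List α) : List (α × α × α) :=
  l.zip ((l.rotate 1).zip (l.rotate 2))

theorem map_cycleTriples_left {α : Type*} (l : List α) :
    (cycleTriples l).map (fun t => (t.1, t.2.1)) = cycleEdges l := by
  apply List.ext_getElem <;> simp [cycleTriples, cycleEdges]

theorem map_cycleTriples_right {α : Type*} (l : List α) :
    (cycleTriples l).map Prod.snd = (cycleEdges l).rotate 1 := by
  have h : (cycleEdges l).rotate 1 = (l.rotate 1).zip ((l.rotate 1).rotate 1) :=
    List.zipWith_rotate_distrib Prod.mk l (l.rotate 1) 1 (List.length_rotate ..).symm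
  rw [h, List.rotate_rotate]
  apply List.ext_getElem <;> simp [cycleTriples]

theorem map_cycleTriples_mid {α : Type*} (l : List α) :
    (cycleTriples l).map (fun t => t.2.1) = l.rotate 1 := by
  apply List.ext_getElem <;> simp [cycleTriples]

theorem mem_cycleEdges_iff_left {α : Type*} {l : List α} {a b : α} :
    (a, b) ∈ cycleEdges l ↔ ∃ c, (a, b, c) ∈ cycleTriples l := by
  simp [← map_cycleTriples_left]

theorem mem_cycleEdges_iff_right {α : Type*} {l : List α} {b c : α} :
    (b, c) ∈ cycleEdges l ↔ ∃ a, (a, b, c) ∈ cycleTriples l := by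
  rw [← List.mem_rotate (n := 1), ← map_cycleTriples_right]
  simp

theorem mid_injOn_flatMap_cycleTriples {α : Type*} {L : List (List α)} (hL : L.flatten.Nodup)
    {s t : α × α × α} (hs : s ∈ L.flatMap cycleTriples) (ht : t ∈ L.flatMap cycleTriples)
    (h : s.2.1 = t.2.1) : s = t := by
  refine List.inj_on_of_nodup_map (f := fun t : α × α × α => t.2.1) ?_ hs ht h
  rw [List.map_flatMap]
  simp only [map_cycleTriples_mid]
  rw [← List.flatMap_id] at hL
  exact (List.Perm.flatMap_left L fun l _ => (l.rotate_perm 1)).nodup_iff.2 hL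

theorem mem_flatMap_cycleEdges_or_iff {α : Type*} {L : List (List α)} {a b : α} :
    (a, b) ∈ L.flatMap cycleEdges ∨ (b, a) ∈ L.flatMap cycleEdges ↔
      ∃ t ∈ L.flatMap cycleTriples, t.2.1 = a ∧ (b = t.1 ∨ b = t.2.2) := by
  simp only [List.mem_flatMap]
  constructor
  · rintro (⟨l, hl, h⟩ | ⟨l, hl, h⟩)
    · obtain ⟨c, hc⟩ := mem_cycleEdges_iff_right.1 h
      exact ⟨_, ⟨l, hl, hc⟩, rfl, .inr rfl⟩
    · obtain ⟨c, hc⟩ := mem_cycleEdges_iff_left.1 h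
      exact ⟨_, ⟨l, hl, hc⟩, rfl, .inl rfl⟩
  · rintro ⟨t, ⟨l, hl, ht⟩, rfl, rfl | rfl⟩
    · exact .inr ⟨l, hl, mem_cycleEdges_iff_left.2 ⟨_, ht⟩⟩
    · exact .inl ⟨l, hl, mem_cycleEdges_iff_right.2 ⟨_, ht⟩⟩

/-- The graph on the `r`-subsets of `Fin n` formed by a family of cycles. -/
def cyclesGraph {n : ℕ} (r : ℕ) (L : List (List (Finset (Fin n)))) :
    SimpleGraph {A : Finset (Fin n) // A.card = r} :=
  SimpleGraph.fromRel fun A B => (A.val, B.val) ∈ L.flatMap cycleEdges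

theorem cyclesGraph_adj {n r : ℕ} {L : List (List (Finset (Fin n)))}
    {A B : {A : Finset (Fin n) // A.card = r}} :
    (cyclesGraph r L).Adj A B ↔
      A ≠ B ∧ ∃ t ∈ L.flatMap cycleTriples, t.2.1 = A.val ∧ (B.val = t.1 ∨ B.val = t.2.2) := by
  rw [cyclesGraph, SimpleGraph.fromRel_adj, mem_flatMap_cycleEdges_or_iff]

theorem cyclesGraph_le_johnson {n r : ℕ} {L : List (List (Finset (Fin n)))}
    (hL : ∀ t ∈ L.flatMap cycleTriples,
      (t.2.1 ∩ t.1).card = r - 1 ∧ (t.2.1 ∩ t.2.2).card = r - 1) :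
    cyclesGraph r L ≤ johnson n r := by
  intro A B h
  obtain ⟨hne, t, ht, hA, hB⟩ := cyclesGraph_adj.1 h
  rw [johnson, SimpleGraph.fromRel_adj, ← hA]
  refine ⟨hne, .inl ?_⟩
  rcases hB with hB | hB <;> rw [hB]
  exacts [(hL t ht).1, (hL t ht).2]

theorem isExact_cyclesGraph {n r : ℕ} {L : List (List (Finset (Fin n)))}
    (hnodup : L.flatten.Nodup)
    (hL : ∀ t ∈ L.flatMap cycleTriples,
      (t.1 ∩ t.2.1 ∩ t.2.2).card = r - 2 ∧ (t.1 ∪ t.2.1 ∪ t.2.2).card = r + 2) :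
    IsExact (cyclesGraph r L) := by
  have key : ∀ u v w, (cyclesGraph r L).Adj u v → (cyclesGraph r L).Adj u w → v ≠ w →
      (v.val ∩ u.val ∩ w.val).card = r - 2 ∧ (v.val ∪ u.val ∪ w.val).card = r + 2 := by
    intro u v w huv huw hvw
    obtain ⟨-, t, ht, hu, hv⟩ := cyclesGraph_adj.1 huv
    obtain ⟨-, s, hs, hu', hw⟩ := cyclesGraph_adj.1 huw
    obtain rfl := mid_injOn_flatMap_cycleTriples hnodup ht hs (hu.trans hu'.symm)
    have hne : v.val ≠ w.val := fun h => hvw (Subtype.ext h)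
    have h := hL t ht
    rw [← hu]
    rcases hv with hv | hv <;> rcases hw with hw | hw
    · exact absurd (hv.trans hw.symm) hne
    · rwa [hv, hw]
    · rw [hv, hw, Finset.inter_comm t.2.2, Finset.inter_right_comm, Finset.inter_comm t.2.1,
        Finset.union_comm t.2.2, Finset.union_right_comm, Finset.union_comm t.2.1]
      exact h
    · exact absurd (hv.trans hw.symm) hne
  refine ⟨fun u v w huv huw hvw => ?_, fun u v w huv hvw huw => (key v u w huv.symm hvw huw).2⟩
  rw [← (key u v w huv huw hvw).1]
  congr 1
  ext x
  simp only [Finset.mem_inter]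
  tauto

theorem ncard_neighborSet_cyclesGraph {n r : ℕ} {L : List (List (Finset (Fin n)))}
    (hnodup : L.flatten.Nodup)
    (hL : ∀ t ∈ L.flatMap cycleTriples, t.2.1 ≠ t.1 ∧ t.2.1 ≠ t.2.2 ∧ t.1 ≠ t.2.2 ∧
      t.1.card = r ∧ t.2.2.card = r)
    (v : {A : Finset (Fin n) // A.card = r}) (hv : v.val ∈ L.flatten) :
    ((cyclesGraph r L).neighborSet v).ncard = 2 := by
  obtain ⟨l, hl, hvl⟩ := List.mem_flatten.1 hv
  rw [← List.mem_rotate (n := 1), ← map_cycleTriples_mid, List.mem_map] at hvl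
  obtain ⟨t, htl, htv⟩ := hvl
  have ht : t ∈ L.flatMap cycleTriples := List.mem_flatMap.2 ⟨l, hl, htl⟩
  obtain ⟨h₁, h₂, h₁₂, hc₁, hc₂⟩ := hL t ht
  have hset : (cyclesGraph r L).neighborSet v = {⟨t.1, hc₁⟩, ⟨t.2.2, hc₂⟩} := by
    ext w
    rw [SimpleGraph.mem_neighborSet, cyclesGraph_adj, Set.mem_insert_iff,
      Set.mem_singleton_iff, Subtype.ext_iff, Subtype.ext_iff]
    constructor
    · rintro ⟨-, s, hs, hsv, hw⟩
      rwa [mid_injOn_flatMap_cycleTriples hnodup hs ht (hsv.trans htv.symm)] at hw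
    · refine fun hw => ⟨fun h => ?_, t, ht, htv, hw⟩
      rw [← h, ← htv] at hw
      exact hw.elim h₁ h₂
  rw [hset, Set.ncard_pair fun h => h₁₂ (congrArg Subtype.val h)]

/-- in `Γ⁴₇`, the three 7-cycles `φ₁, φ₂, φ₃` together with the displayed
14-cycle (all written 0-indexed) are pairwise vertex-disjoint cycles covering all 35
vertices, whose union is an exact 2-factor of `Γ⁴₇`. -/
theorem johnson_7_4_exact_two_factor
    (c1 c2 c3 c4 : List (Finset (Fin 7)))
    (hc1 : c1 = [{0,1,2,3}, {1,2,3,4}, {2,3,4,5}, {3,4,5,6}, {4,5,6,0}, {5,6,0,1},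
      {6,0,1,2}])
    (hc2 : c2 = [{0,2,4,6}, {2,4,6,1}, {4,6,1,3}, {6,1,3,5}, {1,3,5,0}, {3,5,0,2},
      {5,0,2,4}])
    (hc3 : c3 = [{0,3,6,2}, {3,6,2,5}, {6,2,5,1}, {2,5,1,4}, {5,1,4,0}, {1,4,0,3},
      {4,0,3,6}])
    (hc4 : c4 = [{0,1,2,4}, {0,2,3,4}, {3,4,5,0}, {3,5,6,0}, {6,0,1,3}, {6,1,2,3},
      {2,3,4,6}, {2,4,5,6}, {5,6,0,2}, {5,0,1,2}, {1,2,3,5}, {1,3,4,5}, {4,5,6,1},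
      {4,6,0,1}])
    (Ψ : SimpleGraph {A : Finset (Fin 7) // A.card = 4})
    (hΨ : Ψ = SimpleGraph.fromRel fun A B =>
      (A.val, B.val) ∈ cycleEdges c1 ++ cycleEdges c2 ++ cycleEdges c3 ++ cycleEdges c4) :
    (c1 ++ c2 ++ c3 ++ c4).Nodup ∧
    (∀ v : {A : Finset (Fin 7) // A.card = 4}, v.val ∈ c1 ++ c2 ++ c3 ++ c4) ∧
    Ψ ≤ johnson 7 4 ∧ IsExact Ψ ∧ ∀ v, (Ψ.neighborSet v).ncard = 2 := by
  have hnodup : (c1 ++ c2 ++ c3 ++ c4).Nodup := by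
    subst hc1 hc2 hc3 hc4
    simp only [List.cons_append, List.nil_append, List.nodup_cons]
    split_ands
    all_goals first | exact List.nodup_nil | decide +kernel
  have hflat : [c1, c2, c3, c4].flatten = c1 ++ c2 ++ c3 ++ c4 := by simp
  have htriples : ∀ t ∈ [c1, c2, c3, c4].flatMap cycleTriples,
      ((t.2.1 ∩ t.1).card = 4 - 1 ∧ (t.2.1 ∩ t.2.2).card = 4 - 1) ∧
      ((t.1 ∩ t.2.1 ∩ t.2.2).card = 4 - 2 ∧ (t.1 ∪ t.2.1 ∪ t.2.2).card = 4 + 2) ∧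
      (t.2.1 ≠ t.1 ∧ t.2.1 ≠ t.2.2 ∧ t.1 ≠ t.2.2 ∧ t.1.card = 4 ∧ t.2.2.card = 4) := by
    simp only [List.flatMap_cons, List.flatMap_nil, List.append_nil, List.forall_mem_append]
    subst hc1 hc2 hc3 hc4
    simp only [cycleTriples, List.rotate_cons_succ, List.rotate_zero, List.cons_append,
      List.nil_append, List.zip_cons_cons, List.zip_nil_right, List.forall_mem_cons]
    split_ands
    all_goals first | exact List.forall_mem_nil _ | decide +kernel
  have hcard : ∀ A ∈ c1 ++ c2 ++ c3 ++ c4, A.card = 4 := by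
    simp only [List.forall_mem_append]
    subst hc1 hc2 hc3 hc4
    refine ⟨⟨⟨?_, ?_⟩, ?_⟩, ?_⟩ <;> decide +kernel
  have hcover : (c1 ++ c2 ++ c3 ++ c4).toFinset = Finset.powersetCard 4 Finset.univ := by
    refine Finset.eq_of_subset_of_card_le (fun A hA => Finset.mem_powersetCard.2
      ⟨Finset.subset_univ _, hcard A (List.mem_toFinset.1 hA)⟩) ?_
    rw [List.toFinset_card_of_nodup hnodup, Finset.card_powersetCard]
    subst hc1 hc2 hc3 hc4
    decide
  have hmem : ∀ v : {A : Finset (Fin 7) // A.card = 4}, v.val ∈ c1 ++ c2 ++ c3 ++ c4 :=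
    fun v => List.mem_toFinset.1 <| hcover ▸
      Finset.mem_powersetCard.2 ⟨Finset.subset_univ _, v.2⟩
  have hgraph : Ψ = cyclesGraph 4 [c1, c2, c3, c4] := by
    simp [hΨ, cyclesGraph]
  rw [hgraph]
  rw [← hflat] at hnodup hmem ⊢
  exact ⟨hnodup, hmem, cyclesGraph_le_johnson fun t ht => (htriples t ht).1,
    isExact_cyclesGraph hnodup fun t ht => (htriples t ht).2.1,
    fun v => ncard_neighborSet_cyclesGraph hnodup (fun t ht => (htriples t ht).2.2) v (hmem v)⟩
end

section
/- Let r ≥ t ≥ 2 with n = r + t > 4 and 2 < r < n − 1. If the Johnson graph Γ^r_n admits a nest, then the Cayley graph X³_{r,t} has a 1-sphere packing J with exactly n!/(rt) centers, so that the union of the closed neighborhoods N[v], v ∈ J, has cardinality (n/(rt))·n!. -/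
/-- In a finite graph of minimum degree at least two, each vertex can be sent to a neighbour so
that no edge is traversed in both directions. -/
theorem exists_orientation_of_two_le_degree {V : Type*} [Finite V] (G : SimpleGraph V)
    (hG : ∀ v, 2 ≤ (G.neighborSet v).ncard) :
    ∃ f : V → V, ∀ v, G.Adj v (f v) ∧ f (f v) ≠ v := by
  classical
  have := Fintype.ofFinite V
  have hdeg : ∀ v, 2 ≤ G.degree v := fun v => by
    simpa [← G.card_neighborSet_eq_degree, Set.ncard_eq_toFinset_card'] using hG v
  have hall : ∀ S : Finset V, S.card ≤ (S.biUnion fun v => G.incidenceFinset v).card := by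
    intro S
    have h := Finset.card_mul_le_card_mul (s := S) (t := S.biUnion fun v => G.incidenceFinset v)
      (m := 2) (n := 2) (fun v e => v ∈ e) (fun v hv => ?_) (fun e he => ?_)
    · omega
    · refine (hdeg v).trans ?_
      rw [← G.card_incidenceFinset_eq_degree]
      refine Finset.card_le_card fun e he => ?_
      rw [Finset.mem_bipartiteAbove]
      refine ⟨Finset.mem_biUnion.2 ⟨v, hv, he⟩, ?_⟩
      exact ((G.mem_incidenceFinset v e).1 he).2
    · refine (Finset.card_le_card (t := e.toFinset) fun v hv => ?_).trans ?_
      · exact Sym2.mem_toFinset.2 (Finset.mem_bipartiteBelow _ |>.1 hv).2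
      · rw [Sym2.card_toFinset]
        split_ifs <;> simp
  obtain ⟨e, he, hinc⟩ := (Finset.all_card_le_biUnion_card_iff_exists_injective _).1 hall
  have hother : ∀ v, ∃ w, e v = s(v, w) := fun v =>
    Sym2.mem_iff_exists.1 ((G.mem_incidenceFinset v _).1 (hinc v)).2
  choose f hf using hother
  have hadj : ∀ v, G.Adj v (f v) := fun v => by
    have := ((G.mem_incidenceFinset v _).1 (hinc v)).1
    rwa [hf v] at this
  refine ⟨f, fun v => ⟨hadj v, fun hv => (hadj v).ne' (he ?_)⟩⟩
  rw [hf (f v), hf v, hv, Sym2.eq_swap]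

theorem SimpleGraph.Reachable.mem_of_adj_closed {V : Type*} {G : SimpleGraph V} {u v : V}
    (h : G.Reachable u v) {S : Set V} (hS : ∀ x ∈ S, ∀ y, G.Adj x y → y ∈ S) (hu : u ∈ S) :
    v ∈ S := by
  obtain ⟨p⟩ := h
  induction p with
  | nil => exact hu
  | cons hadj _ ih => exact ih (hS _ hu _ hadj)

theorem IsUnicyclicCaterpillar.exists_orientation {V : Type*} [Finite V] {H : SimpleGraph V}
    (hH : IsUnicyclicCaterpillar H) :
    ∃ f : V → V, ∀ v, H.Adj v (f v) ∧ f (f v) ≠ v := by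
  classical
  obtain ⟨hconn, -, hcore, hdeg⟩ := hH
  set D : Set V := {v | 2 ≤ (H.neighborSet v).ncard}
  obtain ⟨f, hf⟩ := exists_orientation_of_two_le_degree (H.induce D) fun v => (hdeg v).ge
  have hleaf : ∀ v ∉ D, ∃ w ∈ D, H.Adj v w := by
    intro v hv
    by_contra! hno
    have hsub : ∀ x ∉ D, ∀ y z, H.Adj x y → H.Adj x z → y = z := fun x hx y z hy hz =>
      (Set.ncard_le_one (Set.toFinite _)).1 (Nat.le_of_lt_succ (not_le.1 hx))
        y hy z hz
    obtain ⟨d⟩ := hcore.nonempty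
    have hmem : d.1 ∈ {x | x ∉ D ∧ (x = v ∨ H.Adj v x)} := by
      refine (hconn.preconnected v d).mem_of_adj_closed ?_ ⟨hv, .inl rfl⟩
      rintro x ⟨hx, rfl | hvx⟩ y hxy
      · exact ⟨fun hy => hno y hy hxy, .inr hxy⟩
      · obtain rfl := hsub x hx y v hxy hvx.symm
        exact ⟨hv, .inl rfl⟩
    exact hmem.1 d.2
  choose! g hgD hg using hleaf
  refine ⟨fun v => if h : v ∈ D then (f ⟨v, h⟩).1 else g v, fun v => ?_⟩
  by_cases h : v ∈ D
  · simp only [h, dite_true, Subtype.coe_prop]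
    exact ⟨(hf ⟨v, h⟩).1, fun he => (hf ⟨v, h⟩).2 (Subtype.ext he)⟩
  · simp only [h, dite_false, hgD v h, dite_true]
    exact ⟨hg v h, fun he => h (he ▸ (f ⟨g v, hgD v h⟩).2)⟩

theorem exists_orientation_of_components {V : Type*} [Finite V] {G : SimpleGraph V}
    (hG : ∀ c : G.ConnectedComponent, IsUnicyclicCaterpillar (G.induce c.supp)) :
    ∃ f : V → V, ∀ v, G.Adj v (f v) ∧ f (f v) ≠ v := by
  choose f hf using fun c => (hG c).exists_orientation
  let F : V → V := fun x => (f (G.connectedComponentMk x) ⟨x, rfl⟩).1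
  have hF : ∀ (c : G.ConnectedComponent) (y : c.supp), F y = f c y := by
    rintro c ⟨y, rfl⟩
    rfl
  refine ⟨F, fun v => ?_⟩
  have hv := hf (G.connectedComponentMk v) ⟨v, rfl⟩
  refine ⟨hv.1, fun he => hv.2 (Subtype.ext ?_)⟩
  rw [← hF]
  exact he

theorem johnson_adj_exists_exchange {n r : ℕ} (hr : 0 < r)
    {A B : {A : Finset (Fin n) // A.card = r}} (h : (johnson n r).Adj A B) :
    ∃ a b, A.1 \ B.1 = {a} ∧ B.1 \ A.1 = {b} := by
  have hAB : (A.1 ∩ B.1).card = r - 1 := by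
    rcases ((SimpleGraph.fromRel_adj _ _ _).1 h).2 with h | h
    · exact h
    · rwa [Finset.inter_comm]
  have h1 := Finset.card_sdiff_add_card_inter A.1 B.1
  have h2 := Finset.card_sdiff_add_card_inter B.1 A.1
  rw [Finset.inter_comm B.1] at h2
  have hA := A.2
  have hB := B.2
  obtain ⟨a, ha⟩ := Finset.card_eq_one.1 (show (A.1 \ B.1).card = 1 by omega)
  obtain ⟨b, hb⟩ := Finset.card_eq_one.1 (show (B.1 \ A.1).card = 1 by omega)
  exact ⟨a, b, ha, hb⟩

/-- A nest lets every `r`-set `A` exchange an element `a A` for a new element `b A`, such that the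
resulting set neither removes the new element nor restores the removed one. -/
theorem HasNest.exists_exchange {n r : ℕ} (hr : 2 ≤ r) (h : HasNest n r) :
    ∃ (f : {A : Finset (Fin n) // A.card = r} → {A : Finset (Fin n) // A.card = r})
      (a b : {A : Finset (Fin n) // A.card = r} → Fin n),
      (∀ A, A.1 \ (f A).1 = {a A}) ∧ (∀ A, (f A).1 \ A.1 = {b A}) ∧
      (∀ A, a (f A) ≠ b A) ∧ ∀ A, b (f A) ≠ a A := by
  obtain ⟨Ψ, hle, ⟨hcol, hunion⟩, -, hcomp⟩ := h
  obtain ⟨f, hf⟩ := exists_orientation_of_components hcomp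
  choose a b ha hb using fun A =>
    johnson_adj_exists_exchange (by omega) (hle (hf A).1)
  refine ⟨f, a, b, ha, hb, fun A he => ?_, fun A he => ?_⟩
  · have h1 := hcol (f A) A (f (f A)) (hf A).1.symm (hf (f A)).1 (hf A).2.symm
    have h2 : ((f A).1 ∩ A.1) ∩ ((f A).1 ∩ (f (f A)).1) = (f A).1.erase (b A) := by
      have h3 := hb A
      have h4 := ha (f A)
      rw [he] at h4
      ext x
      have h5 := Finset.ext_iff.1 h3 x
      have h6 := Finset.ext_iff.1 h4 x
      simp only [Finset.mem_sdiff, Finset.mem_singleton, Finset.mem_inter,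
        Finset.mem_erase] at *
      tauto
    have hbm : b A ∈ (f A).1 := (Finset.mem_sdiff.1 (hb A ▸ Finset.mem_singleton_self _)).1
    rw [h2, Finset.card_erase_of_mem hbm, (f A).2] at h1
    omega
  · have h1 := hunion A (f A) (f (f A)) (hf A).1 (hf (f A)).1 (hf A).2.symm
    have h2 : A.1 ∪ (f A).1 ∪ (f (f A)).1 ⊆ insert (b A) A.1 := by
      intro x hx
      have ham : a A ∈ A.1 := (Finset.mem_sdiff.1 (ha A ▸ Finset.mem_singleton_self _)).1
      have h5 := Finset.ext_iff.1 (hb A) x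
      have h6 := Finset.ext_iff.1 (hb (f A)) x
      rw [he] at h6
      simp only [Finset.mem_sdiff, Finset.mem_singleton, Finset.mem_union,
        Finset.mem_insert] at *
      by_cases hxa : x = a A
      · subst hxa
        exact .inr ham
      · tauto
    have h3 := (Finset.card_le_card h2).trans (Finset.card_insert_le _ _)
    have := A.2
    omega

/-- The set of points that `g` sends below `r`. -/
def leftSet (r t : ℕ) (g : Equiv.Perm (Fin (r + t))) :
    {A : Finset (Fin (r + t)) // A.card = r} :=
  ⟨Finset.univ.filter fun i => (g i : ℕ) < r, by
    rw [← Finset.card_map g.toEmbedding]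
    have : (Finset.univ.filter fun i => (g i : ℕ) < r).map g.toEmbedding =
        (Finset.univ : Finset (Fin r)).map (Fin.castAddEmb t) := by
      ext x
      simp only [Finset.mem_map, Finset.mem_filter, Finset.mem_univ, true_and]
      constructor
      · rintro ⟨i, hi, rfl⟩
        exact ⟨⟨g i, hi⟩, rfl⟩
      · rintro ⟨i, rfl⟩
        exact ⟨g.symm (Fin.castAdd t i), by simp, by simp⟩
    rw [this, Finset.card_map, Finset.card_univ, Fintype.card_fin]⟩

theorem mem_leftSet {r t : ℕ} {g : Equiv.Perm (Fin (r + t))} {i : Fin (r + t)} :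
    i ∈ (leftSet r t g).1 ↔ (g i : ℕ) < r := by
  simp [leftSet]

/-- Swapping within both sides: `L` with `p` on the left and `R` with `q` on the right. -/
theorem leftSet_swap_mul_swap_mul {r t : ℕ} {L p R q : Fin (r + t)} (hL : (L : ℕ) < r)
    (hp : (p : ℕ) < r) (hR : r ≤ (R : ℕ)) (hq : r ≤ (q : ℕ)) (g : Equiv.Perm (Fin (r + t))) :
    leftSet r t (Equiv.swap L p * Equiv.swap R q * g) = leftSet r t g := by
  ext i
  simp only [mem_leftSet, Equiv.Perm.mul_apply, Equiv.swap_apply_def]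
  split_ifs <;> simp_all <;> omega

theorem swap_mul_swap_mul_self {r n : ℕ} {L p R q : Fin n} (hL : (L : ℕ) < r)
    (hp : (p : ℕ) < r) (hR : r ≤ (R : ℕ)) (hq : r ≤ (q : ℕ)) (g : Equiv.Perm (Fin n)) :
    Equiv.swap L p * Equiv.swap R q * (Equiv.swap L p * Equiv.swap R q * g) = g := by
  have hcomm : Equiv.swap L p * Equiv.swap R q = Equiv.swap R q * Equiv.swap L p := by
    rw [Equiv.mul_swap_eq_swap_mul, Equiv.swap_apply_of_ne_of_ne, Equiv.swap_apply_of_ne_of_ne]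
    all_goals rintro rfl; omega
  rw [← mul_assoc]
  nth_rewrite 1 [hcomm]
  simp [mul_assoc]

theorem closedNbr_X3_cases {r t : ℕ} {L R : Fin (r + t)} (hL : (L : ℕ) = r - 1) (hr : 0 < r)
    (hR : (R : ℕ) = r) {g x : Equiv.Perm (Fin (r + t))} (h : x ∈ closedNbr (X3 r t) g) :
    (∃ p q : Fin (r + t), (p : ℕ) < r ∧ r ≤ (q : ℕ) ∧ (p = L ∨ q = R) ∧
      x = Equiv.swap L p * Equiv.swap R q * g) ∨ x = Equiv.swap L R * g := by
  have key : ∀ i j : Fin (r + t),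
      (((i : ℕ) < r - 1 ∧ (j : ℕ) = r - 1) ∨ ((i : ℕ) = r - 1 ∧ (j : ℕ) = r) ∨
        ((i : ℕ) = r ∧ r < (j : ℕ))) → x = Equiv.swap i j * g →
      (∃ p q : Fin (r + t), (p : ℕ) < r ∧ r ≤ (q : ℕ) ∧ (p = L ∨ q = R) ∧
      x = Equiv.swap L p * Equiv.swap R q * g) ∨ x = Equiv.swap L R * g := by
    rintro i j (⟨hi, hj⟩ | ⟨hi, hj⟩ | ⟨hi, hj⟩) hx
    · obtain rfl : j = L := Fin.ext (by omega)
      exact .inl ⟨i, R, by omega, by omega, .inr rfl, by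
        rw [hx, Equiv.swap_self, Equiv.swap_comm]
        rfl⟩
    · obtain rfl : i = L := Fin.ext (by omega)
      obtain rfl : j = R := Fin.ext (by omega)
      exact .inr hx
    · obtain rfl : i = R := Fin.ext (by omega)
      exact .inl ⟨L, j, by omega, by omega, .inl rfl, by
        rw [hx, Equiv.swap_self]
        rfl⟩
  rcases h with rfl | h
  · exact .inl ⟨L, R, by omega, by omega, .inl rfl, by
      rw [Equiv.swap_self, Equiv.swap_self]
      rfl⟩
  · rw [SimpleGraph.mem_neighborSet, X3, cayley] at h
    obtain ⟨i, j, hij, hx⟩ : ∃ i j, (doubleStar r t).Adj i j ∧ x = Equiv.swap i j * g := by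
      rcases ((SimpleGraph.fromRel_adj _ _ _).1 h).2 with ⟨i, j, hij, h⟩ | ⟨i, j, hij, h⟩
      · exact ⟨i, j, hij, by rw [← h]; simp⟩
      · exact ⟨i, j, hij, by rw [← Equiv.swap_inv, ← h]; simp⟩
    rcases ((SimpleGraph.fromRel_adj _ _ _).1 hij).2 with hij | hij
    · exact key i j hij hx
    · exact key j i hij (by rw [hx, Equiv.swap_comm])

/-- for `r ≥ t ≥ 2` with `n = r + t > 4` and `2 < r < n - 1`, if `Γ^r_n`
has a nest then `X³_{r,t}` has a 1-sphere packing with exactly `n!/(rt)` centers. -/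
theorem nest_gives_uniform_packing (r t : ℕ) (ht : 2 ≤ t) (htr : t ≤ r)
    (hn : 4 < r + t) (hr2 : 2 < r) (hrn : r < r + t - 1)
    (hnest : HasNest (r + t) r) :
    ∃ J : Set (Equiv.Perm (Fin (r + t))), IsSpherePacking (X3 r t) J ∧
      r * t * J.ncard = (r + t).factorial := by
  obtain ⟨f, a, b, ha, hb, hab, hba⟩ := hnest.exists_exchange hr2.le
  obtain ⟨L, hL⟩ : ∃ L : Fin (r + t), (L : ℕ) = r - 1 := ⟨⟨r - 1, by omega⟩, rfl⟩
  obtain ⟨R, hR⟩ : ∃ R : Fin (r + t), (R : ℕ) = r := ⟨⟨r, by omega⟩, rfl⟩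
  have hLR : L ≠ R := fun h => by rw [h] at hL; omega
  have ham : ∀ A, a A ∈ A.1 := fun A =>
    (Finset.mem_sdiff.1 (ha A ▸ Finset.mem_singleton_self _)).1
  have hbm : ∀ A, b A ∉ A.1 := fun A =>
    (Finset.mem_sdiff.1 (hb A ▸ Finset.mem_singleton_self _)).2
  let J : Set (Equiv.Perm (Fin (r + t))) :=
    {g | g (a (leftSet r t g)) = L ∧ g (b (leftSet r t g)) = R}
  let m (p q : Fin (r + t)) (g : Equiv.Perm (Fin (r + t))) :=
    Equiv.swap L p * Equiv.swap R q * g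
  have hm : ∀ {p q : Fin (r + t)}, (p : ℕ) < r → r ≤ (q : ℕ) → ∀ g ∈ J,
      leftSet r t (m p q g) = leftSet r t g ∧
      m p q g (a (leftSet r t (m p q g))) = p ∧ m p q g (b (leftSet r t (m p q g))) = q := by
    intro p q hp hq g hg
    have h := leftSet_swap_mul_swap_mul (L := L) (R := R) (by omega) hp (by omega) hq g
    refine ⟨h, ?_, ?_⟩ <;> simp only [m, h]
    · rw [Equiv.Perm.mul_apply, Equiv.Perm.mul_apply, hg.1,
        Equiv.swap_apply_of_ne_of_ne hLR (by rintro rfl; omega), Equiv.swap_apply_left]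
    · rw [Equiv.Perm.mul_apply, Equiv.Perm.mul_apply, hg.2, Equiv.swap_apply_left,
        Equiv.swap_apply_of_ne_of_ne (by rintro rfl; omega) (by rintro rfl; omega)]
  have hinj : ∀ {p q p' q' : Fin (r + t)}, (p : ℕ) < r → r ≤ (q : ℕ) → (p' : ℕ) < r →
      r ≤ (q' : ℕ) → ∀ g ∈ J, ∀ g' ∈ J, m p q g = m p' q' g' → p = p' ∧ q = q' ∧ g = g' := by
    intro p q p' q' hp hq hp' hq' g hg g' hg' h
    obtain ⟨-, h1, h2⟩ := hm hp hq g hg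
    obtain ⟨-, h3, h4⟩ := hm hp' hq' g' hg'
    rw [h] at h1 h2
    obtain rfl := h1.symm.trans h3
    obtain rfl := h2.symm.trans h4
    exact ⟨rfl, rfl, mul_left_cancel h⟩
  have hcross : ∀ h ∈ J, leftSet r t (Equiv.swap L R * h) = f (leftSet r t h) := by
    intro h hh
    ext i
    have h1 := Finset.ext_iff.1 (ha (leftSet r t h)) i
    have h2 := Finset.ext_iff.1 (hb (leftSet r t h)) i
    have h3 : h i = L ↔ i = a (leftSet r t h) := by rw [← hh.1, h.injective.eq_iff]
    have h4 : h i = R ↔ i = b (leftSet r t h) := by rw [← hh.2, h.injective.eq_iff]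
    simp only [Finset.mem_sdiff, Finset.mem_singleton, mem_leftSet, ← h3, ← h4] at h1 h2
    rw [mem_leftSet, Equiv.Perm.mul_apply, Equiv.swap_apply_def]
    split_ifs with h5 h6
    · have : (h i : ℕ) < r := by rw [h5]; omega
      have : ¬ (R : ℕ) < r := by omega
      tauto
    · have : (L : ℕ) < r := by omega
      tauto
    · tauto
  have hmixed : ∀ {p q : Fin (r + t)}, (p : ℕ) < r → r ≤ (q : ℕ) → (p = L ∨ q = R) →
      ∀ g ∈ J, ∀ h ∈ J, m p q g ≠ Equiv.swap L R * h := by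
    intro p q hp hq hpq g hg h hh he
    obtain ⟨-, h1, h2⟩ := hm hp hq g hg
    rw [he, hcross h hh] at h1 h2
    rcases hpq with rfl | rfl
    · refine hab (leftSet r t h) ((Equiv.swap p R * h).injective (h1.trans ?_))
      rw [Equiv.Perm.mul_apply, hh.2, Equiv.swap_apply_right]
    · refine hba (leftSet r t h) ((Equiv.swap L q * h).injective (h2.trans ?_))
      rw [Equiv.Perm.mul_apply, hh.1, Equiv.swap_apply_left]
  refine ⟨J, fun g hg h hh hne => Set.disjoint_left.2 fun x hxg hxh => ?_, ?_⟩
  · rcases closedNbr_X3_cases hL (by omega) hR hxg with ⟨p, q, hp, hq, hpq, hx⟩ | hx <;>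
      rcases closedNbr_X3_cases hL (by omega) hR hxh with ⟨p', q', hp', hq', hpq', hx'⟩ | hx'
    · exact hne (hinj hp hq hp' hq' g hg h hh (hx.symm.trans hx')).2.2
    · exact hmixed hp hq hpq g hg h hh (hx.symm.trans hx')
    · exact hmixed hp' hq' hpq' h hh g hg (hx'.symm.trans hx)
    · exact hne (mul_left_cancel (hx.symm.trans hx'))
  · let F : (Fin r × Fin t) × J → Equiv.Perm (Fin (r + t)) := fun x =>
      m (Fin.castAdd t x.1.1) (Fin.natAdd r x.1.2) x.2
    have hF : Function.Bijective F := by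
      constructor
      · rintro ⟨⟨p, q⟩, g, hg⟩ ⟨⟨p', q'⟩, g', hg'⟩ h
        obtain ⟨h1, h2, rfl⟩ := hinj (by simp) (by simp) (by simp) (by simp) g hg g' hg' h
        simp_all
      · intro h
        have hp : (h (a (leftSet r t h)) : ℕ) < r := mem_leftSet.1 (ham _)
        have hq : r ≤ (h (b (leftSet r t h)) : ℕ) := not_lt.1 (mt mem_leftSet.2 (hbm _))
        have hs := leftSet_swap_mul_swap_mul (L := L) (R := R) (by omega) hp (by omega) hq h
        refine ⟨⟨⟨⟨_, hp⟩, ⟨h (b (leftSet r t h)) - r, by omega⟩⟩,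
          ⟨m (h (a (leftSet r t h))) (h (b (leftSet r t h))) h, ?_, ?_⟩⟩, ?_⟩
        · simp only [m, hs]
          rw [Equiv.Perm.mul_apply, Equiv.Perm.mul_apply, Equiv.swap_apply_of_ne_of_ne
            (a := R) (fun h' => by rw [h'] at hp; omega) (fun h' => by rw [h'] at hp; omega),
            Equiv.swap_apply_right]
        · simp only [m, hs]
          rw [Equiv.Perm.mul_apply, Equiv.Perm.mul_apply, Equiv.swap_apply_right,
            Equiv.swap_apply_of_ne_of_ne hLR.symm (fun h' => by rw [← h'] at hp; omega)]
        · have e1 : Fin.castAdd t ⟨h (a (leftSet r t h)), hp⟩ = h (a (leftSet r t h)) := rfl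
          have e2 : Fin.natAdd r ⟨h (b (leftSet r t h)) - r, by omega⟩ =
              h (b (leftSet r t h)) := Fin.ext (by simp; omega)
          simp only [F, e1, e2]
          exact swap_mul_swap_mul_self (by omega) hp (by omega) hq h
    have hcard := Nat.card_congr (Equiv.ofBijective F hF)
    rwa [Nat.card_prod, Nat.card_prod, Nat.card_fin, Nat.card_fin, Nat.card_coe_set_eq,
      Nat.card_perm, Nat.card_fin] at hcard
end

section
/- In the Cayley graph of S₄ with connection set the transpositions {(1 2), (2 3), (3 4)} (adjacency: g ~ h iff hg⁻¹ is one of these transpositions), the maximum cardinality of a 1-sphere packing is exactly 5; that is, there exist 5 permutations whose closed neighborhoods (each of size 4) are pairwise disjoint, covering 20 of the 24 vertices, but there do not exist 6 such permutations (so this graph has no efficient dominating set). -/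
open Equiv in
/-- Summing over the permutations of sign `ε` sending `3` to `i`: left translation by an odd
permutation `s` moves this class to the one of sign `-ε` sending `3` to `s i`. -/
theorem sum_signClass_mul_left (x : Perm (Fin 4) → ℤ) (s : Perm (Fin 4))
    (hs : Perm.sign s = -1) (ε : ℤˣ) (i : Fin 4) :
    ∑ h with Perm.sign h = ε ∧ h 3 = i, x (s * h) =
      ∑ h with Perm.sign h = -ε ∧ h 3 = s i, x h := by
  refine Finset.sum_equiv (Equiv.mulLeft s) (fun h => ?_) (fun h _ => rfl)
  simp [hs]

open Equiv in
theorem card_signClass (ε : ℤˣ) (i : Fin 4) :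
    (Finset.univ.filter fun h : Perm (Fin 4) => Perm.sign h = ε ∧ h 3 = i).card = 3 := by
  revert ε i
  decide

open Equiv in
/-- No integer-valued function on `S₄` sums to `1` over every closed neighborhood. -/
theorem not_forall_sum_closedNbr_eq_one (x : Perm (Fin 4) → ℤ)
    (hx : ∀ h, x h + x (swap 0 1 * h) + x (swap 1 2 * h) + x (swap 2 3 * h) = 1) : False := by
  set a : ℤˣ → Fin 4 → ℤ := fun ε i => ∑ h with Perm.sign h = ε ∧ h 3 = i, x h with ha
  have key : ∀ ε i, a ε i + a (-ε) ((swap 0 1 : Perm (Fin 4)) i) +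
      a (-ε) ((swap 1 2 : Perm (Fin 4)) i) + a (-ε) ((swap 2 3 : Perm (Fin 4)) i) = 3 := by
    intro ε i
    simp only [ha]
    rw [← sum_signClass_mul_left x _ (Perm.sign_swap (by decide)),
      ← sum_signClass_mul_left x _ (Perm.sign_swap (by decide)),
      ← sum_signClass_mul_left x _ (Perm.sign_swap (by decide)),
      ← Finset.sum_add_distrib, ← Finset.sum_add_distrib, ← Finset.sum_add_distrib,
      Finset.sum_congr rfl fun h _ => hx h, Finset.sum_const, card_signClass]
    rfl
  have p0 : a 1 0 + a (-1) 1 + a (-1) 0 + a (-1) 0 = 3 := key 1 0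
  have p1 : a 1 1 + a (-1) 0 + a (-1) 2 + a (-1) 1 = 3 := key 1 1
  have p2 : a 1 2 + a (-1) 2 + a (-1) 1 + a (-1) 3 = 3 := key 1 2
  have p3 : a 1 3 + a (-1) 3 + a (-1) 3 + a (-1) 2 = 3 := key 1 3
  have m0 : a (-1) 0 + a 1 1 + a 1 0 + a 1 0 = 3 := key (-1) 0
  have m1 : a (-1) 1 + a 1 0 + a 1 2 + a 1 1 = 3 := key (-1) 1
  have m2 : a (-1) 2 + a 1 2 + a 1 1 + a 1 3 = 3 := key (-1) 2
  have m3 : a (-1) 3 + a 1 3 + a 1 3 + a 1 2 = 3 := key (-1) 3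
  omega

open Equiv in
/-- Adjacency in the Cayley graph of `S₄` for the adjacent transpositions. -/
theorem fromRel_adjacentSwap_adj (g h : Perm (Fin 4)) :
    (SimpleGraph.fromRel fun g h : Perm (Fin 4) =>
      h * g⁻¹ = swap 0 1 ∨ h * g⁻¹ = swap 1 2 ∨ h * g⁻¹ = swap 2 3).Adj g h ↔
    h = swap 0 1 * g ∨ h = swap 1 2 * g ∨ h = swap 2 3 * g := by
  have flip : ∀ i j : Fin 4, g = swap i j * h ↔ h = swap i j * g := fun i j =>
    ⟨fun e => by rw [e, swap_mul_self_mul], fun e => by rw [e, swap_mul_self_mul]⟩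
  simp only [SimpleGraph.fromRel_adj, mul_inv_eq_iff_eq_mul, flip, or_self, and_iff_right_iff_imp]
  rintro h' rfl
  simp only [right_eq_mul, swap_eq_one_iff] at h'
  revert h'
  decide

open Equiv in
theorem closedNbr_fromRel_adjacentSwap (g : Perm (Fin 4)) :
    closedNbr (SimpleGraph.fromRel fun g h : Perm (Fin 4) =>
      h * g⁻¹ = swap 0 1 ∨ h * g⁻¹ = swap 1 2 ∨ h * g⁻¹ = swap 2 3) g =
    (({g, swap 0 1 * g, swap 1 2 * g, swap 2 3 * g} : Finset (Perm (Fin 4))) :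
      Set (Perm (Fin 4))) := by
  ext h
  simp [closedNbr, -SimpleGraph.fromRel_adj, fromRel_adjacentSwap_adj]

open Equiv in
/-- The four members of a closed neighborhood in `S₄` are distinct. -/
theorem adjacentSwap_mul_pairwise_ne (g : Perm (Fin 4)) :
    g ≠ swap 0 1 * g ∧ g ≠ swap 1 2 * g ∧ g ≠ swap 2 3 * g ∧
    swap 0 1 * g ≠ swap 1 2 * g ∧ swap 0 1 * g ≠ swap 2 3 * g ∧
    swap 1 2 * g ≠ swap 2 3 * g := by
  simp only [ne_eq, mul_left_inj, right_eq_mul]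
  decide

/-- Among four pairwise incompatible propositions at most one holds. -/
theorem ite_add_ite_le_one {p q r s : Prop} [Decidable p] [Decidable q] [Decidable r]
    [Decidable s] (hpq : p → ¬q) (hpr : p → ¬r) (hps : p → ¬s) (hqr : q → ¬r) (hqs : q → ¬s)
    (hrs : r → ¬s) :
    (if p then (1 : ℤ) else 0) + (if q then 1 else 0) + (if r then 1 else 0) +
      (if s then 1 else 0) ≤ 1 := by
  by_cases p <;> by_cases q <;> by_cases r <;> by_cases s <;> simp_all

/-- in the Cayley graph of `S₄` with connection set
`{(1 2), (2 3), (3 4)}` (0-indexed: `{(0 1), (1 2), (2 3)}`), the maximum cardinality of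
a 1-sphere packing is exactly 5; in particular this graph has no efficient dominating
set. -/
theorem path_S4_max_packing_five
    (G : SimpleGraph (Equiv.Perm (Fin 4)))
    (hG : G = SimpleGraph.fromRel fun g h =>
      h * g⁻¹ = Equiv.swap 0 1 ∨ h * g⁻¹ = Equiv.swap 1 2 ∨ h * g⁻¹ = Equiv.swap 2 3) :
    (∃ J : Set (Equiv.Perm (Fin 4)), IsSpherePacking G J ∧ J.ncard = 5) ∧
    (∀ J : Set (Equiv.Perm (Fin 4)), IsSpherePacking G J → J.ncard ≤ 5) ∧
    ¬ ∃ J : Set (Equiv.Perm (Fin 4)), IsEDS G J := by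
  classical
  have adj : ∀ g h, G.Adj g h ↔
      h = Equiv.swap 0 1 * g ∨ h = Equiv.swap 1 2 * g ∨ h = Equiv.swap 2 3 * g := fun g h => by
    rw [hG]
    exact fromRel_adjacentSwap_adj g h
  have nbr : ∀ g, closedNbr G g = (({g, Equiv.swap 0 1 * g, Equiv.swap 1 2 * g,
      Equiv.swap 2 3 * g} : Finset (Equiv.Perm (Fin 4))) : Set (Equiv.Perm (Fin 4))) := fun g => by
    rw [hG]
    exact closedNbr_fromRel_adjacentSwap g
  refine ⟨?_, ?_, ?_⟩
  · refine ⟨(({1, Equiv.swap 1 3, Equiv.swap 0 2, Equiv.swap 0 2 * Equiv.swap 1 3,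
      Equiv.swap 0 2 * Equiv.swap 2 3 * Equiv.swap 3 1} : Finset (Equiv.Perm (Fin 4))) :
      Set (Equiv.Perm (Fin 4))), fun u hu v hv huv => ?_, ?_⟩
    · show Disjoint (closedNbr G u) (closedNbr G v)
      rw [nbr, nbr, Finset.disjoint_coe]
      rw [Finset.mem_coe] at hu hv
      revert u v
      decide
    · rw [Set.ncard_coe_finset]
      decide
  · intro J hJ
    by_contra! hcard
    set x : Equiv.Perm (Fin 4) → ℤ := fun h => if h ∈ J then 1 else 0 with hx
    have sep : ∀ u ∈ J, ∀ v ∈ J, u ≠ v → ∀ w ∈ closedNbr G u, w ∉ closedNbr G v :=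
      fun u hu v hv huv w hw => Set.disjoint_left.mp (hJ hu hv huv) hw
    have le : ∀ h ∈ Finset.univ, x h + x (Equiv.swap 0 1 * h) + x (Equiv.swap 1 2 * h) +
        x (Equiv.swap 2 3 * h) ≤ 1 := by
      intro h _
      have m0 : h ∈ closedNbr G h := by simp [nbr]
      have m1 : h ∈ closedNbr G (Equiv.swap 0 1 * h) := by simp [nbr]
      have m2 : h ∈ closedNbr G (Equiv.swap 1 2 * h) := by simp [nbr]
      have m3 : h ∈ closedNbr G (Equiv.swap 2 3 * h) := by simp [nbr]
      obtain ⟨n1, n2, n3, n4, n5, n6⟩ := adjacentSwap_mul_pairwise_ne h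
      exact ite_add_ite_le_one (fun hu hv => sep _ hu _ hv n1 h m0 m1)
        (fun hu hv => sep _ hu _ hv n2 h m0 m2) (fun hu hv => sep _ hu _ hv n3 h m0 m3)
        (fun hu hv => sep _ hu _ hv n4 h m1 m2) (fun hu hv => sep _ hu _ hv n5 h m1 m3)
        (fun hu hv => sep _ hu _ hv n6 h m2 m3)
    have shift : ∀ s, ∑ h, x (s * h) = ∑ h, x h := fun s => Equiv.sum_comp (Equiv.mulLeft s) x
    have total : ∑ h, x h = J.ncard := by
      simp [hx, Set.ncard_eq_toFinset_card', Set.toFinset_card, Fintype.card_subtype]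
    have sum_eq : ∑ h, (x h + x (Equiv.swap 0 1 * h) + x (Equiv.swap 1 2 * h) +
        x (Equiv.swap 2 3 * h)) = ∑ _h : Equiv.Perm (Fin 4), 1 := by
      refine le_antisymm (Finset.sum_le_sum le) ?_
      simp only [Finset.sum_add_distrib, shift, total, Finset.sum_const, Finset.card_univ,
        Fintype.card_perm, Fintype.card_fin, Nat.factorial, nsmul_eq_mul]
      push_cast
      omega
    exact not_forall_sum_closedNbr_eq_one x fun h =>
      (Finset.sum_eq_sum_iff_of_le le).mp sum_eq h (Finset.mem_univ h)
  · rintro ⟨J, hind, hdom⟩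
    refine not_forall_sum_closedNbr_eq_one (fun h => if h ∈ J then 1 else 0) fun h => ?_
    by_cases hh : h ∈ J
    · have e : ∀ s, G.Adj h (s * h) → s * h ∉ J := fun s hs hm => hind h hh _ hm hs
      simp [hh, e _ ((adj _ _).mpr (Or.inl rfl)), e _ ((adj _ _).mpr (Or.inr (Or.inl rfl))),
        e _ ((adj _ _).mpr (Or.inr (Or.inr rfl)))]
    · obtain ⟨u, ⟨hu, hau⟩, huniq⟩ := hdom h hh
      obtain ⟨-, -, -, n4, n5, n6⟩ := adjacentSwap_mul_pairwise_ne h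
      have mem : ∀ s, G.Adj h (s * h) → (s * h ∈ J ↔ s * h = u) := fun s hs =>
        ⟨fun hm => huniq _ ⟨hm, hs⟩, fun e => e ▸ hu⟩
      rw [adj] at hau
      simp only [hh, mem _ ((adj _ _).mpr (Or.inl rfl)),
        mem _ ((adj _ _).mpr (Or.inr (Or.inl rfl))), mem _ ((adj _ _).mpr (Or.inr (Or.inr rfl)))]
      rcases hau with rfl | rfl | rfl
      · simp [n4.symm, n5.symm, -mul_left_inj]
      · simp [n4, n6.symm, -mul_left_inj]
      · simp [n5, n6, -mul_left_inj]
end
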